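/- (Key velocity estimate, Lemma 2.1, θ-component.) There exists a universal constant C₁ ≥ 1 with the following property. Let ω : S² → ℝ be bounded measurable and odd-odd symmetric, and for r > 0 let M_r ∈ [0,∞] denote the Lipschitz constant of ω̃ restricted to [0,r]×[0,r]. Then for every (φ,θ) ∈ [0,1]²∖{(0,0)}, writing x = x(φ,θ), | u(x)·e_θ(x) − (x₃/√(1−x₃²)) · (4x₁/π) ∫_{Q(3φ/2, 3θ/2)} (y₂ y₃ / |y−x₀|⁴) ω(y) dσ(y) | ≤ (x₃/√(1−x₃²)) · C₁ · min{ ‖ω‖_{L∞} (1 + ln(1 + φ/θ)), ‖ω‖_{L∞} + M_{3φ/2} · φ }. -/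

import Mathlib

open MeasureTheory Real Filter Set
open scoped ENNReal NNReal

noncomputable section

abbrev E3 : Type := EuclideanSpace ℝ (Fin 3)

/-- The vector `(a, b, c)` in `ℝ³`. -/
def vec3 (a b c : ℝ) : E3 := (WithLp.equiv 2 (Fin 3 → ℝ)).symm ![a, b, c]

/-- Euclidean dot product in `ℝ³`. -/
def dot3 (x y : E3) : ℝ := x 0 * y 0 + x 1 * y 1 + x 2 * y 2

/-- Cross product in `ℝ³`. -/
def cross3 (x y : E3) : E3 :=
  vec3 (x 1 * y 2 - x 2 * y 1) (x 2 * y 0 - x 0 * y 2) (x 0 * y 1 - x 1 * y 0)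

/-- The unit sphere `S²` in `ℝ³`. -/
def S2 : Set E3 := Metric.sphere (0 : E3) 1

/-- The surface measure on `S²`: the 2-dimensional Hausdorff measure restricted to `S²`. -/
def sigma2 : Measure E3 := (μH[2] : Measure E3).restrict S2

/-- Spherical coordinates. -/
def sc (φ θ : ℝ) : E3 := vec3 (cos θ * cos φ) (cos θ * sin φ) (sin θ)

/-- The Biot–Savart velocity of a vorticity `ω` on the sphere. -/
def biotSavart (ω : E3 → ℝ) (x : E3) : E3 :=
  (2 * Real.pi)⁻¹ • ∫ y, (‖x - y‖ ^ 2)⁻¹ • ω y • cross3 x y ∂sigma2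

/-- The unit tangent vector `e_φ`. -/
def ephi (y : E3) : E3 := vec3 (-(y 1) / sqrt (1 - (y 2) ^ 2)) (y 0 / sqrt (1 - (y 2) ^ 2)) 0

/-- The unit tangent vector `e_θ`. -/
def etheta (y : E3) : E3 :=
  vec3 (-(y 2) * y 0 / sqrt (1 - (y 2) ^ 2)) (-(y 2) * y 1 / sqrt (1 - (y 2) ^ 2))
    (sqrt (1 - (y 2) ^ 2))

/-- Reflection in the second coordinate: `ỹ`. -/
def flip2 (y : E3) : E3 := vec3 (y 0) (-(y 1)) (y 2)

/-- Reflection in the third coordinate: `ȳ`. -/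
def flip3 (y : E3) : E3 := vec3 (y 0) (y 1) (-(y 2))

/-- `ω` is odd-odd symmetric on the sphere. -/
def OddOdd (ω : E3 → ℝ) : Prop := ∀ x ∈ S2, ω (flip2 x) = -ω x ∧ ω (flip3 x) = -ω x

def x₀ : E3 := vec3 1 0 0

/-- The region `Q(k₁, k₂)` on the sphere. -/
def Qset (k₁ k₂ : ℝ) : Set E3 :=
  (fun p : ℝ × ℝ => sc p.1 p.2) '' (Ioo k₁ Real.pi ×ˢ Ioo k₂ (Real.pi / 2))

/-- The open quarter sphere. -/
def S2q : Set E3 := {y ∈ S2 | 0 < y 1 ∧ 0 < y 2}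

/-- The (possibly infinite) Lipschitz constant of `f` on the set `s`. -/
def lipOn (f : ℝ × ℝ → ℝ) (s : Set (ℝ × ℝ)) : ℝ≥0∞ :=
  ⨆ p ∈ s, ⨆ q ∈ s, edist (f p) (f q) / edist p q

@[simp] lemma vec3_0 (a b c : ℝ) : vec3 a b c 0 = a := rfl
@[simp] lemma vec3_1 (a b c : ℝ) : vec3 a b c 1 = b := rfl
@[simp] lemma vec3_2 (a b c : ℝ) : vec3 a b c 2 = c := rfl

lemma nsq (x : E3) : ‖x‖ ^ 2 = x 0 ^ 2 + x 1 ^ 2 + x 2 ^ 2 := by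
  rw [EuclideanSpace.norm_sq_eq, Fin.sum_univ_three]; simp

lemma nsq_sub (x y : E3) :
    ‖x - y‖ ^ 2 = (x 0 - y 0) ^ 2 + (x 1 - y 1) ^ 2 + (x 2 - y 2) ^ 2 := by
  rw [nsq]; simp

lemma mem_S2 (x : E3) : x ∈ S2 ↔ x 0 ^ 2 + x 1 ^ 2 + x 2 ^ 2 = 1 := by
  rw [← nsq, S2, mem_sphere_zero_iff_norm]
  constructor
  · intro h; rw [h]; norm_num
  · intro h; nlinarith [norm_nonneg x]

lemma sc_mem (φ θ : ℝ) : sc φ θ ∈ S2 := by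
  rw [mem_S2]; simp only [sc, vec3_0, vec3_1, vec3_2]
  nlinarith [sin_sq_add_cos_sq φ, sin_sq_add_cos_sq θ]

/-- coordinate map -/
def scp (p : ℝ × ℝ) : E3 := sc p.1 p.2

lemma dist_sc (φ θ a b : ℝ) : ‖sc φ θ - sc a b‖ ^ 2 =
    2 * (1 - cos (θ - b)) + 2 * (cos θ * cos b) * (1 - cos (φ - a)) := by
  rw [nsq_sub]; simp only [sc, vec3_0, vec3_1, vec3_2, cos_sub]
  have h1 := sin_sq_add_cos_sq φ
  have h2 := sin_sq_add_cos_sq θ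
  have h3 := sin_sq_add_cos_sq a
  have h4 := sin_sq_add_cos_sq b
  linear_combination (cos θ)^2 * h1 + h2 + (cos b)^2 * h3 + h4

lemma dist_sc_le (φ θ a b : ℝ) : ‖sc φ θ - sc a b‖ ^ 2 ≤ (φ - a) ^ 2 + (θ - b) ^ 2 := by
  rw [dist_sc]
  have h1 := one_sub_sq_div_two_le_cos (x := θ - b)
  have h2 := one_sub_sq_div_two_le_cos (x := φ - a)
  have h3 : cos θ * cos b ≤ 1 := by
    have : |cos θ * cos b| ≤ 1 := by
      rw [abs_mul]; exact mul_le_one₀ (abs_cos_le_one _) (abs_nonneg _) (abs_cos_le_one _)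
    exact (abs_le.1 this).2
  have h4 : 0 ≤ 1 - cos (φ - a) := by linarith [cos_le_one (φ - a)]
  nlinarith

lemma scp_lip : LipschitzWith 2 scp := by
  apply LipschitzWith.of_dist_le_mul
  rintro ⟨a, b⟩ ⟨c, d⟩
  rw [dist_eq_norm]
  have h := dist_sc_le a b c d
  have h1 : |a - c| ≤ dist (a, b) (c, d) := by
    rw [Prod.dist_eq]; exact le_max_left _ _
  have h2 : |b - d| ≤ dist (a, b) (c, d) := by
    rw [Prod.dist_eq]; exact le_max_right _ _
  simp only [scp]
  have h0 : 0 ≤ dist (a, b) (c, d) := dist_nonneg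
  rw [← sq_abs (a - c), ← sq_abs (b - d)] at h
  apply le_of_sq_le_sq _ (by positivity) |>.trans_eq rfl
  have e1 := pow_le_pow_left₀ (abs_nonneg _) h1 2
  have e2 := pow_le_pow_left₀ (abs_nonneg _) h2 2
  simp only [NNReal.coe_ofNat]
  nlinarith

lemma scp_cont : Continuous scp := scp_lip.continuous
lemma scp_meas : Measurable scp := scp_cont.measurable

lemma S2_meas : MeasurableSet S2 := Metric.isClosed_sphere.measurableSet

lemma co_meas (i : Fin 3) : Measurable (fun y : E3 => y i) := by fun_prop

lemma S2q_meas : MeasurableSet S2q := by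
  apply S2_meas.inter
  exact (measurableSet_lt measurable_const (co_meas 1)).inter
    (measurableSet_lt measurable_const (co_meas 2))

def Df : Set (ℝ × ℝ) := Icc (-π) π ×ˢ Icc (-(π/2)) (π/2)
def Dq : Set (ℝ × ℝ) := Ioo 0 π ×ˢ Ioo 0 (π/2)

lemma E3_ext {x y : E3} (h0 : x 0 = y 0) (h1 : x 1 = y 1) (h2 : x 2 = y 2) : x = y := by
  ext i; fin_cases i <;> assumption

lemma scp_surj (y : E3) (hy : y ∈ S2) : ∃ p ∈ Df, scp p = y := by
  rw [mem_S2] at hy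
  have hy2 : -1 ≤ y 2 ∧ y 2 ≤ 1 := by constructor <;> nlinarith [sq_nonneg (y 0), sq_nonneg (y 1)]
  set z : ℂ := ⟨y 0, y 1⟩
  have hz : ‖z‖ = √(1 - y 2 ^ 2) := by
    rw [Complex.norm_eq_sqrt_sq_add_sq]; congr 1; simp only [z]; linarith
  refine ⟨(Complex.arg z, arcsin (y 2)), ?_, ?_⟩
  · exact ⟨⟨(Complex.neg_pi_lt_arg z).le, Complex.arg_le_pi z⟩, ⟨neg_pi_div_two_le_arcsin _, arcsin_le_pi_div_two _⟩⟩
  · have h0 := Complex.norm_mul_cos_arg z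
    have h1 := Complex.norm_mul_sin_arg z
    rw [hz] at h0 h1
    apply E3_ext
    · simp only [scp, sc, vec3_0, cos_arcsin]; exact h0
    · simp only [scp, sc, vec3_1, cos_arcsin]; exact h1
    · simp only [scp, sc, vec3_2]; exact sin_arcsin hy2.1 hy2.2

lemma mH_le (S : Set E3) (D : Set (ℝ × ℝ)) (hS : MeasurableSet S) (hD : MeasurableSet D)
    (h : ∀ y ∈ S, ∃ p ∈ D, scp p = y) :
    (μH[2] : Measure E3).restrict S ≤ (4 : ℝ≥0∞) • (volume.restrict D).map scp := by
  rw [Measure.le_iff]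
  intro s hs
  rw [Measure.restrict_apply hs, Measure.smul_apply, Measure.map_apply scp_meas hs,
    Measure.restrict_apply (scp_meas hs)]
  have h1 : s ∩ S ⊆ scp '' (scp ⁻¹' s ∩ D) := by
    rintro y ⟨hys, hyS⟩
    obtain ⟨p, hp, rfl⟩ := h y hyS
    exact ⟨p, ⟨hys, hp⟩, rfl⟩
  refine (measure_mono h1).trans ((scp_lip.hausdorffMeasure_image_le (by norm_num) _).trans ?_)
  rw [hausdorffMeasure_prod_real]
  simp only [smul_eq_mul]
  gcongr
  norm_num

lemma Df_meas : MeasurableSet Df := measurableSet_Icc.prod measurableSet_Icc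
lemma Dq_meas : MeasurableSet Dq := measurableSet_Ioo.prod measurableSet_Ioo

lemma sigma2_le : sigma2 ≤ (4 : ℝ≥0∞) • (volume.restrict Df).map scp :=
  mH_le _ _ S2_meas Df_meas scp_surj

lemma S2q_param (y : E3) (hy : y ∈ S2q) : ∃ p ∈ Dq, scp p = y := by
  obtain ⟨hS, h1, h2⟩ := hy
  obtain ⟨⟨a, b⟩, ⟨⟨ha1, ha2⟩, ⟨hb1, hb2⟩⟩, rfl⟩ := scp_surj y hS
  refine ⟨(a, b), ?_, rfl⟩
  simp only [scp, sc, vec3_1, vec3_2] at *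
  have hb0 : 0 < b := by
    by_contra hb
    have := sin_nonpos_of_nonpos_of_neg_pi_le (not_lt.1 hb) (by linarith [pi_pos])
    linarith
  have hb3 : b < π/2 := by
    rcases hb2.lt_or_eq with h | h
    · exact h
    · rw [h, cos_pi_div_two] at h1; simp at h1
  have hc : 0 < cos b := cos_pos_of_mem_Ioo ⟨by linarith [pi_pos], hb3⟩
  have hs : 0 < sin a := by
    by_contra h; push Not at h
    nlinarith
  have ha0 : 0 < a := by
    by_contra hb
    have := sin_nonpos_of_nonpos_of_neg_pi_le (not_lt.1 hb) (by linarith [pi_pos])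
    linarith
  have ha3 : a < π := by
    rcases ha2.lt_or_eq with h | h
    · exact h
    · rw [h, sin_pi] at hs; simp at hs
  exact ⟨⟨ha0, ha3⟩, ⟨hb0, hb3⟩⟩

lemma scp_mem_q {p : ℝ × ℝ} (hp : p ∈ Dq) : scp p ∈ S2q := by
  obtain ⟨⟨a1, a2⟩, ⟨b1, b2⟩⟩ := hp
  refine ⟨sc_mem _ _, ?_, ?_⟩
  · simp only [scp, sc, vec3_1]
    exact mul_pos (cos_pos_of_mem_Ioo ⟨by linarith [pi_pos], b2⟩) (sin_pos_of_pos_of_lt_pi a1 a2)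
  · simp only [scp, sc, vec3_2]
    exact sin_pos_of_pos_of_lt_pi b1 (by linarith [pi_pos])

def sgq : Measure E3 := (μH[2] : Measure E3).restrict S2q

lemma sgq_le : sgq ≤ (4 : ℝ≥0∞) • (volume.restrict Dq).map scp :=
  mH_le _ _ S2q_meas Dq_meas S2q_param

lemma lint_sgq_le (f : E3 → ℝ≥0∞) (hf : Measurable f) :
    ∫⁻ y, f y ∂sgq ≤ 4 * ∫⁻ p in Dq, f (scp p) := by
  refine (lintegral_mono' sgq_le le_rfl).trans ?_
  rw [lintegral_smul_measure, lintegral_map hf scp_meas]; rfl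

lemma scp_inj : InjOn scp Dq := by
  rintro ⟨a, b⟩ ⟨⟨a1, a2⟩, ⟨b1, b2⟩⟩ ⟨c, d⟩ ⟨⟨c1, c2⟩, ⟨d1, d2⟩⟩ h
  simp only at *
  have e0 := congrArg (fun y : E3 => y 0) h
  have e2 := congrArg (fun y : E3 => y 2) h
  simp only [scp, sc, vec3_0, vec3_2] at e0 e2
  have hbd : b = d := injOn_sin ⟨by linarith, by linarith⟩ ⟨by linarith, by linarith⟩ e2
  subst hbd
  have hc : 0 < cos b := cos_pos_of_mem_Ioo ⟨by linarith, b2⟩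
  have := mul_left_cancel₀ hc.ne' e0
  have hac : a = c := injOn_cos ⟨by linarith, by linarith⟩ ⟨by linarith, by linarith⟩ this
  rw [hac]

lemma Q_sub {k l : ℝ} (hk : 0 ≤ k) (hl : 0 ≤ l) :
    Ioo k π ×ˢ Ioo l (π/2) ⊆ Dq := prod_mono (Ioo_subset_Ioo_left hk) (Ioo_subset_Ioo_left hl)

lemma Q_meas {k l : ℝ} (hk : 0 ≤ k) (hl : 0 ≤ l) : MeasurableSet (Qset k l) :=
  (measurableSet_Ioo.prod measurableSet_Ioo).image_of_continuousOn_injOn scp_cont.continuousOn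
    (scp_inj.mono (Q_sub hk hl))

lemma Q_sub_S2q {k l : ℝ} (hk : 0 ≤ k) (hl : 0 ≤ l) : Qset k l ⊆ S2q := by
  rintro _ ⟨p, hp, rfl⟩
  exact scp_mem_q (Q_sub hk hl hp)

lemma scp_mem_Q {k l : ℝ} (hk : 0 ≤ k) (hl : 0 ≤ l) {p : ℝ × ℝ} (hp : p ∈ Dq) :
    scp p ∈ Qset k l ↔ k < p.1 ∧ l < p.2 := by
  constructor
  · rintro ⟨q, hq, h⟩
    have := scp_inj (Q_sub hk hl hq) hp h
    subst this
    exact ⟨hq.1.1, hq.2.1⟩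
  · rintro ⟨h1, h2⟩
    exact ⟨p, ⟨⟨h1, hp.1.2⟩, ⟨h2, hp.2.2⟩⟩, rfl⟩

lemma flip2_isom : Isometry flip2 := by
  apply Isometry.of_dist_eq
  intro x y
  rw [dist_eq_norm, dist_eq_norm, ← sq_eq_sq₀ (norm_nonneg _) (norm_nonneg _), nsq_sub, nsq_sub]
  simp only [flip2, vec3_0, vec3_1, vec3_2]; ring

lemma flip3_isom : Isometry flip3 := by
  apply Isometry.of_dist_eq
  intro x y
  rw [dist_eq_norm, dist_eq_norm, ← sq_eq_sq₀ (norm_nonneg _) (norm_nonneg _), nsq_sub, nsq_sub]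
  simp only [flip3, vec3_0, vec3_1, vec3_2]; ring

lemma flip2_invol (y : E3) : flip2 (flip2 y) = y := by
  apply E3_ext <;> simp [flip2]
lemma flip3_invol (y : E3) : flip3 (flip3 y) = y := by
  apply E3_ext <;> simp [flip3]

lemma mp_of (f g : E3 → E3) (hf : Isometry f) (hfg : ∀ y, f (g y) = y) :
    MeasurePreserving f (μH[2] : Measure E3) (μH[2] : Measure E3) :=
  (IsometryEquiv.mk' f g hfg hf).measurePreserving_hausdorffMeasure 2

def flip23 (y : E3) : E3 := flip2 (flip3 y)

lemma flip23_invol (y : E3) : flip23 (flip23 y) = y := by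
  apply E3_ext <;> simp [flip23, flip2, flip3]

lemma flip23_isom : Isometry flip23 := flip2_isom.comp flip3_isom

lemma map_flip (f : E3 → E3) (hf : Isometry f) (hff : ∀ y, f (f y) = y) :
    sgq.map f = (μH[2] : Measure E3).restrict (f ⁻¹' S2q) := by
  have hm : MeasurableSet (f ⁻¹' S2q) := hf.continuous.measurable S2q_meas
  have h := (mp_of f f hf hff).restrict_preimage hm
  have e : f ⁻¹' (f ⁻¹' S2q) = S2q := by
    ext y; simp [hff]
  rw [e] at h
  exact h.map_eq

lemma line_null (u : ℝ) : (volume : Measure (ℝ × ℝ)) {p | p.1 = u} = 0 := by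
  have : {p : ℝ × ℝ | p.1 = u} = {u} ×ˢ univ := by ext p; simp
  rw [this, Measure.volume_eq_prod, Measure.prod_prod]; simp
lemma line_null' (u : ℝ) : (volume : Measure (ℝ × ℝ)) {p | p.2 = u} = 0 := by
  have : {p : ℝ × ℝ | p.2 = u} = univ ×ˢ {u} := by ext p; simp
  rw [this, Measure.volume_eq_prod, Measure.prod_prod]; simp

lemma null_of (S : Set E3) (hS : MeasurableSet S)
    (h : ∀ p ∈ Df, scp p ∈ S → p.1 = -π ∨ p.1 = 0 ∨ p.1 = π ∨ p.2 = -(π/2) ∨ p.2 = 0 ∨ p.2 = π/2) :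
    sigma2 S = 0 := by
  have h1 := sigma2_le S
  rw [Measure.smul_apply, Measure.map_apply scp_meas hS, Measure.restrict_apply (scp_meas hS)] at h1
  have : volume (scp ⁻¹' S ∩ Df) = 0 := by
    apply measure_mono_null (t := {p | p.1 = -π} ∪ ({p | p.1 = 0} ∪ ({p | p.1 = π} ∪
      ({p | p.2 = -(π/2)} ∪ ({p | p.2 = 0} ∪ {p | p.2 = π/2})))))
    · rintro p ⟨h1, h2⟩
      exact h p h2 h1
    · simp only [measure_union_null_iff, line_null, line_null', and_self]
  rw [this] at h1
  simpa using h1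

lemma null1 : sigma2 {y | y 1 = 0} = 0 := by
  apply null_of _ (measurableSet_eq_fun (co_meas 1) measurable_const)
  rintro ⟨a, b⟩ ⟨⟨ha1, ha2⟩, ⟨hb1, hb2⟩⟩ h
  simp only [scp, sc, vec3_1, mem_ofPred_eq, mul_eq_zero] at *
  rcases h with h | h
  · by_contra hh; push Not at hh
    have : 0 < cos b := cos_pos_of_mem_Ioo ⟨lt_of_le_of_ne hb1 (Ne.symm hh.2.2.2.1), lt_of_le_of_ne hb2 hh.2.2.2.2.2⟩
    linarith
  · by_contra hh; push Not at hh
    rcases lt_or_gt_of_ne hh.2.1 with h0 | h0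
    · have := sin_neg_of_neg_of_neg_pi_lt h0 (lt_of_le_of_ne ha1 (Ne.symm hh.1))
      linarith
    · have := sin_pos_of_pos_of_lt_pi h0 (lt_of_le_of_ne ha2 hh.2.2.1)
      linarith

lemma null2 : sigma2 {y | y 2 = 0} = 0 := by
  apply null_of _ (measurableSet_eq_fun (co_meas 2) measurable_const)
  rintro ⟨a, b⟩ ⟨⟨ha1, ha2⟩, ⟨hb1, hb2⟩⟩ h
  simp only [scp, sc, vec3_2, mem_ofPred_eq] at *
  have : b = 0 := by
    apply injOn_sin ⟨by linarith, by linarith⟩ ⟨by linarith [pi_pos], by linarith [pi_pos]⟩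
    simpa using h
  tauto

lemma fold_measure :
    sigma2 = sgq + sgq.map flip2 + sgq.map flip3 + sgq.map flip23 := by
  rw [map_flip _ flip2_isom flip2_invol, map_flip _ flip3_isom flip3_invol,
    map_flip _ flip23_isom flip23_invol, sgq]
  have m2 := flip2_isom.continuous.measurable S2q_meas
  have m3 := flip3_isom.continuous.measurable S2q_meas
  have m23 := flip23_isom.continuous.measurable S2q_meas
  have p1 : ∀ y, y ∈ S2q ↔ y ∈ S2 ∧ 0 < y 1 ∧ 0 < y 2 := fun y => Iff.rfl
  have p2 : ∀ y, y ∈ flip2 ⁻¹' S2q ↔ y ∈ S2 ∧ y 1 < 0 ∧ 0 < y 2 := by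
    intro y; simp [S2q, flip2, mem_S2]
  have p3 : ∀ y, y ∈ flip3 ⁻¹' S2q ↔ y ∈ S2 ∧ 0 < y 1 ∧ y 2 < 0 := by
    intro y; simp [S2q, flip3, mem_S2]
  have p4 : ∀ y, y ∈ flip23 ⁻¹' S2q ↔ y ∈ S2 ∧ y 1 < 0 ∧ y 2 < 0 := by
    intro y; simp [S2q, flip23, flip2, flip3, mem_S2]
  rw [← Measure.restrict_union _ m2, ← Measure.restrict_union _ m3, ← Measure.restrict_union _ m23]
  · rw [sigma2]
    apply Measure.restrict_congr_set
    have n1 : (μH[2] : Measure E3) ({y | y 1 = 0} ∩ S2) = 0 := by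
      have := null1
      rwa [sigma2, Measure.restrict_apply (measurableSet_eq_fun (co_meas 1) measurable_const)] at this
    have n2 : (μH[2] : Measure E3) ({y | y 2 = 0} ∩ S2) = 0 := by
      have := null2
      rwa [sigma2, Measure.restrict_apply (measurableSet_eq_fun (co_meas 2) measurable_const)] at this
    have n1' := measure_eq_zero_iff_ae_notMem.1 n1
    have n2' := measure_eq_zero_iff_ae_notMem.1 n2
    filter_upwards [n1', n2'] with y h1 h2
    apply propext
    change y ∈ S2 ↔ y ∈ (S2q ∪ flip2 ⁻¹' S2q ∪ flip3 ⁻¹' S2q ∪ flip23 ⁻¹' S2q : Set E3)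
    simp only [mem_union, p1, p2, p3, p4]
    simp only [mem_inter_iff, mem_ofPred_eq, not_and] at h1 h2
    constructor
    · intro h
      have g1 : y 1 ≠ 0 := fun e => h1 e h
      have g2 : y 2 ≠ 0 := fun e => h2 e h
      rcases lt_or_gt_of_ne g1 with a | a <;> rcases lt_or_gt_of_ne g2 with b | b <;> tauto
    · tauto
  · rw [Set.disjoint_left]; intro y; simp only [mem_union, p1, p2, p3, p4]
    rintro ((⟨_, a, b⟩ | ⟨_, a, b⟩) | ⟨_, a, b⟩) ⟨_, c, d⟩ <;> linarith
  · rw [Set.disjoint_left]; intro y; simp only [mem_union, p1, p2, p3]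
    rintro (⟨_, a, b⟩ | ⟨_, a, b⟩) ⟨_, c, d⟩ <;> linarith
  · rw [Set.disjoint_left]; intro y; simp only [p1, p2]
    rintro ⟨_, a, b⟩ ⟨_, c, d⟩; linarith

lemma flip2_meas : Measurable flip2 := flip2_isom.continuous.measurable
lemma flip3_meas : Measurable flip3 := flip3_isom.continuous.measurable
lemma flip23_meas : Measurable flip23 := flip23_isom.continuous.measurable

lemma fold_lint (f : E3 → ℝ≥0∞) (hf : Measurable f) :
    ∫⁻ y, f y ∂sigma2 = ∫⁻ y, f y ∂sgq + ∫⁻ y, f (flip2 y) ∂sgq + ∫⁻ y, f (flip3 y) ∂sgq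
      + ∫⁻ y, f (flip23 y) ∂sgq := by
  rw [fold_measure, lintegral_add_measure, lintegral_add_measure, lintegral_add_measure,
    lintegral_map hf flip2_meas, lintegral_map hf flip3_meas, lintegral_map hf flip23_meas]

lemma fold_int (f : E3 → ℝ) (hfm : Measurable f) (hf : Integrable f sigma2) :
    Integrable (fun y => f y + f (flip2 y) + f (flip3 y) + f (flip23 y)) sgq ∧
    ∫ y, f y ∂sigma2 = ∫ y, (f y + f (flip2 y) + f (flip3 y) + f (flip23 y)) ∂sgq := by
  rw [fold_measure, integrable_add_measure, integrable_add_measure, integrable_add_measure] at hf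
  obtain ⟨⟨⟨h1, h2⟩, h3⟩, h4⟩ := hf
  have g2 := (integrable_map_measure hfm.aestronglyMeasurable flip2_meas.aemeasurable).1 h2
  have g3 := (integrable_map_measure hfm.aestronglyMeasurable flip3_meas.aemeasurable).1 h3
  have g4 := (integrable_map_measure hfm.aestronglyMeasurable flip23_meas.aemeasurable).1 h4
  have i12 := h1.add g2
  have i123 := i12.add g3
  refine ⟨i123.add g4, ?_⟩
  rw [fold_measure, integral_add_measure ((h1.add_measure h2).add_measure h3) h4,
    integral_add_measure (h1.add_measure h2) h3, integral_add_measure h1 h2,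
    integral_map flip2_meas.aemeasurable hfm.aestronglyMeasurable,
    integral_map flip3_meas.aemeasurable hfm.aestronglyMeasurable,
    integral_map flip23_meas.aemeasurable hfm.aestronglyMeasurable]
  have e1 := integral_add h1 g2
  have e2 := integral_add i12 g3
  have e3 := integral_add i123 g4
  simp only [Pi.add_apply, Function.comp] at e1 e2 e3
  rw [e3, e2, e1]

lemma lint_ftc {g g' : ℝ → ℝ} {a b : ℝ} (hab : a ≤ b) (hcont : ContinuousOn g (Icc a b))
    (hderiv : ∀ x ∈ Ioo a b, HasDerivAt g (g' x) x) (hpos : ∀ x ∈ Ioo a b, 0 ≤ g' x) :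
    ∫⁻ x in Ioo a b, ENNReal.ofReal (g' x) = ENNReal.ofReal (g b - g a) := by
  have hi := intervalIntegral.integrableOn_deriv_of_nonneg hcont hderiv hpos
  have h := intervalIntegral.integral_eq_sub_of_hasDerivAt_of_le hab hcont hderiv
    ((intervalIntegrable_iff_integrableOn_Ioc_of_le hab).2 hi)
  rw [← h, intervalIntegral.integral_of_le hab, integral_Ioc_eq_integral_Ioo,
    ofReal_integral_eq_lintegral_ofReal (hi.mono_set Ioo_subset_Ioc_self)]
  exact (ae_restrict_iff' measurableSet_Ioo).2 (Eventually.of_forall hpos)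

/-- even functions -/
lemma lint_abs (f : ℝ → ℝ≥0∞) (L m : ℝ) (S : Set ℝ) (hS : ∀ x ∈ S, |x - m| < L) :
    ∫⁻ x in S, f |x - m| ≤ 2 * ∫⁻ x in Ioo 0 L, f x := by
  have h1 : ∫⁻ x in Ioo m (m + L), f |x - m| = ∫⁻ x in Ioo 0 L, f x := by
    rw [← lintegral_indicator measurableSet_Ioo, ← lintegral_indicator measurableSet_Ioo,
      ← lintegral_sub_right_eq_self ((Ioo 0 L).indicator f) m]
    congr 1; ext x
    by_cases hx : x ∈ Ioo m (m + L)
    · have : x - m ∈ Ioo 0 L := ⟨by linarith [hx.1], by linarith [hx.2]⟩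
      rw [indicator_of_mem hx, indicator_of_mem this, abs_of_pos this.1]
    · have : x - m ∉ Ioo 0 L := fun h => hx ⟨by linarith [h.1], by linarith [h.2]⟩
      rw [indicator_of_notMem hx, indicator_of_notMem this]
  have h2 : ∫⁻ x in Ioo (m - L) m, f |x - m| = ∫⁻ x in Ioo 0 L, f x := by
    rw [← lintegral_indicator measurableSet_Ioo, ← lintegral_indicator measurableSet_Ioo,
      ← lintegral_sub_left_eq_self ((Ioo 0 L).indicator f) m]
    congr 1; ext x
    by_cases hx : x ∈ Ioo (m - L) m
    · have : m - x ∈ Ioo 0 L := ⟨by linarith [hx.2], by linarith [hx.1]⟩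
      rw [indicator_of_mem hx, indicator_of_mem this, abs_sub_comm, abs_of_pos this.1]
    · have : m - x ∉ Ioo 0 L := fun h => hx ⟨by linarith [h.2], by linarith [h.1]⟩
      rw [indicator_of_notMem hx, indicator_of_notMem this]
  have hsub : S ⊆ (Ioo (m - L) m ∪ Ioo m (m + L)) ∪ {m} := by
    intro x hx
    have := abs_lt.1 (hS x hx)
    rcases lt_trichotomy x m with h | h | h
    · exact Or.inl (Or.inl ⟨by linarith, h⟩)
    · exact Or.inr h
    · exact Or.inl (Or.inr ⟨h, by linarith⟩)
  refine (lintegral_mono_set hsub).trans ((lintegral_union_le _ _ _).trans ?_)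
  have h3 : ∫⁻ x in {m}, f |x - m| = 0 := by simp
  rw [h3, add_zero]
  refine (lintegral_union_le _ _ _).trans ?_
  rw [h1, h2, two_mul]

lemma lint_inv_sqrt (L : ℝ) (hL : 0 ≤ L) :
    ∫⁻ x in Ioo 0 L, ENNReal.ofReal (1 / √x) = ENNReal.ofReal (2 * √L) := by
  have := lint_ftc (g := fun x => 2 * √x) (g' := fun x => 1 / √x) hL (by fun_prop)
    (fun x hx => by
      have h := (hasDerivAt_sqrt hx.1.ne').const_mul 2
      refine h.congr_deriv ?_
      have : 0 < √x := sqrt_pos.2 hx.1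
      field_simp)
    (fun x hx => by positivity)
  simpa using this

lemma lint_arctan_sqrt (L θ : ℝ) (hL : 0 ≤ L) (hθ : 0 < θ) :
    ∫⁻ x in Ioo 0 L, ENNReal.ofReal (1 / (√x * (x + θ))) ≤ ENNReal.ofReal (4 / √θ) := by
  have := lint_ftc (g := fun x => 2 / √θ * arctan (√x / √θ)) (g' := fun x => 1 / (√x * (x + θ))) hL
    (by fun_prop)
    (fun x hx => by
      have h := (((hasDerivAt_sqrt hx.1.ne').div_const (√θ)).arctan).const_mul (2 / √θ)
      refine h.congr_deriv ?_
      have : 0 < √x := sqrt_pos.2 hx.1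
      have : 0 < √θ := sqrt_pos.2 hθ
      have e1 := sq_sqrt hx.1.le
      have e2 := sq_sqrt hθ.le
      have : 0 < x + θ := by linarith [hx.1]
      have hxx := hx.1
      rw [div_pow, e1, e2]
      have : 0 < 1 + x / θ := by positivity
      field_simp
      rw [e2]; ring)
    (fun x hx => by have := hx.1; positivity)
  rw [this]
  apply ENNReal.ofReal_le_ofReal
  simp only [sqrt_zero, zero_div, arctan_zero, mul_zero, sub_zero]
  have h1 := arctan_lt_pi_div_two (√L / √θ)
  have h2 : arctan (√L / √θ) ≤ 2 := by linarith [pi_lt_four]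
  have : 0 < √θ := sqrt_pos.2 hθ
  rw [div_mul_eq_mul_div]
  gcongr; linarith

lemma lint_cauchy (k l m b : ℝ) (hkl : k ≤ l) (hb : 0 < b) :
    ∫⁻ x in Ioo k l, ENNReal.ofReal (1 / ((x - m) ^ 2 + b ^ 2)) ≤ ENNReal.ofReal (4 / b) := by
  have := lint_ftc (g := fun x => 1 / b * arctan ((x - m) / b))
    (g' := fun x => 1 / ((x - m) ^ 2 + b ^ 2)) hkl (by fun_prop)
    (fun x hx => by
      have h := ((((hasDerivAt_id x).sub_const m).div_const b).arctan).const_mul (1 / b)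
      refine h.congr_deriv ?_
      simp only [id]
      field_simp
      ring)
    (fun x hx => by positivity)
  rw [this]
  apply ENNReal.ofReal_le_ofReal
  have h1 := arctan_lt_pi_div_two ((l - m) / b)
  have h2 := neg_pi_div_two_lt_arctan ((k - m) / b)
  rw [← mul_sub, div_mul_eq_mul_div, one_mul]
  gcongr; linarith [pi_lt_four]

lemma lint_const (k l c : ℝ) (h : k ≤ l) (hc : 0 ≤ c) :
    ∫⁻ _ in Ioo k l, ENNReal.ofReal c = ENNReal.ofReal (c * (l - k)) := by
  rw [setLIntegral_const, Real.volume_Ioo, ENNReal.ofReal_mul hc]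

lemma lint_cauchy2 (φ b : ℝ) (hφ : 0 ≤ φ) (hb : 0 < b) :
    ∫⁻ x in Ioo 0 (3 * φ / 2), ENNReal.ofReal (1 / ((x - φ) ^ 2 + b ^ 2)) ≤
      ENNReal.ofReal (3 / 2 * φ / b ^ 2) := by
  refine (lintegral_mono (g := fun _ => ENNReal.ofReal (1 / b ^ 2)) fun x => ?_).trans ?_
  · apply ENNReal.ofReal_le_ofReal
    apply one_div_le_one_div_of_le (by positivity); nlinarith [sq_nonneg (x - φ)]
  · rw [lint_const _ _ _ (by positivity) (by positivity)]
    apply ENNReal.ofReal_le_ofReal; apply le_of_eq; ring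

lemma lint_cauchy3 (φ b : ℝ) (hφ : 0 ≤ φ) (hb : 0 < b) :
    ∫⁻ x in Ioo 0 (3 * φ / 2), ENNReal.ofReal (1 / ((x - φ) ^ 2 + b ^ 2)) ≤
      ENNReal.ofReal (8 * (φ / (b * (b + φ)))) := by
  have h1 := lint_cauchy 0 (3 * φ / 2) φ b (by positivity) hb
  have h2 := lint_cauchy2 φ b hφ hb
  rcases le_total φ b with h | h
  · refine h2.trans (ENNReal.ofReal_le_ofReal ?_)
    rw [← mul_div_assoc, div_le_div_iff₀ (by positivity) (by positivity)]
    nlinarith [mul_nonneg (mul_nonneg hφ hb.le) (sub_nonneg.2 h), mul_nonneg (mul_nonneg hφ hb.le) hb.le]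
  · refine h1.trans (ENNReal.ofReal_le_ofReal ?_)
    rw [← mul_div_assoc, div_le_div_iff₀ (by positivity) (by positivity)]
    nlinarith [mul_nonneg hb.le (sub_nonneg.2 h), mul_nonneg hb.le hb.le]

lemma lint_log (φ k l : ℝ) (hφ : 0 ≤ φ) (hk : 0 < k) (hkl : k ≤ l) :
    ∫⁻ b in Ioo k l, ENNReal.ofReal (φ / (b * (b + φ))) ≤ ENNReal.ofReal (log (1 + φ / k)) := by
  have := lint_ftc (g := fun b => log b - log (b + φ)) (g' := fun b => φ / (b * (b + φ))) hkl
    (by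
      apply ContinuousOn.sub
      · exact continuousOn_log.mono (fun x hx => by have := hx.1; simp; linarith)
      · apply ContinuousOn.log (by fun_prop)
        intro x hx; have := hx.1; linarith)
    (fun x hx => by
      have h0 : 0 < x := hk.trans hx.1
      have h := (hasDerivAt_log h0.ne').sub (((hasDerivAt_id x).add_const φ).log (by simp; linarith))
      refine h.congr_deriv ?_
      simp only [id]
      have : x + φ ≠ 0 := by linarith
      field_simp
      ring)
    (fun x hx => by have h0 : 0 < x := hk.trans hx.1; positivity)
  rw [this]
  apply ENNReal.ofReal_le_ofReal
  have hl : 0 < l := by linarith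
  have h1 : log l ≤ log (l + φ) := log_le_log hl (by linarith)
  have h2 : log (1 + φ / k) = log (k + φ) - log k := by
    rw [← log_div (by linarith) hk.ne']; congr 1; field_simp
  linarith

lemma lint_sqinv (φ k l : ℝ) (hφ : 0 ≤ φ) (hk : 0 < k) (hkl : k ≤ l) :
    ∫⁻ b in Ioo k l, ENNReal.ofReal (φ / b ^ 2) ≤ ENNReal.ofReal (φ / k) := by
  have := lint_ftc (g := fun b => - (φ / b)) (g' := fun b => φ / b ^ 2) hkl
    (by
      apply ContinuousOn.neg
      apply ContinuousOn.div (by fun_prop) (by fun_prop)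
      intro x hx; have := hx.1; linarith)
    (fun x hx => by
      have h0 : 0 < x := hk.trans hx.1
      have h := ((hasDerivAt_inv h0.ne').const_mul φ).neg
      refine h.congr_deriv ?_
      field_simp)
    (fun x hx => by positivity)
  rw [this]
  apply ENNReal.ofReal_le_ofReal
  have hl : 0 < l := by linarith
  have : 0 ≤ φ / l := by positivity
  linarith

lemma lint_cube (k l e : ℝ) (hk : 0 < k + e) (hkl : k ≤ l) :
    ∫⁻ b in Ioo k l, ENNReal.ofReal (1 / (e + b) ^ 3) ≤ ENNReal.ofReal (1 / (e + k) ^ 2) := by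
  have := lint_ftc (g := fun b => - (1 / 2 * ((e + b) ^ 2)⁻¹)) (g' := fun b => 1 / (e + b) ^ 3) hkl
    (by
      apply ContinuousOn.neg
      apply ContinuousOn.mul (by fun_prop)
      apply ContinuousOn.inv₀ (by fun_prop)
      intro x hx; have := hx.1; have : 0 < e + x := by linarith
      positivity)
    (fun x hx => by
      have h0 : 0 < e + x := by linarith [hx.1]
      have h := (((((hasDerivAt_id x).const_add e).pow 2).inv (by simp; positivity)).const_mul (1/2)).neg
      refine h.congr_deriv ?_
      simp only [id]
      simp
      field_simp)
    (fun x hx => by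
      have h0 : 0 < e + x := by linarith [hx.1]
      positivity)
  rw [this]
  apply ENNReal.ofReal_le_ofReal
  have h1 : 0 < e + l := by linarith
  have h2 : 0 < e + k := by linarith
  have : 0 < ((e + l) ^ 2)⁻¹ := by positivity
  have : 0 < ((e + k) ^ 2)⁻¹ := by positivity
  rw [one_div ((e + k) ^ 2)]; linarith

lemma lint_cubeD (φ θ : ℝ) (hφ : 0 ≤ φ) (hθ : 0 ≤ θ) (h : 0 < φ + θ) (h1 : 3 * φ / 2 ≤ π)
    (h2 : 3 * θ / 2 ≤ π / 2) :
    ∫⁻ p in Ioo (3 * φ / 2) π ×ˢ Ioo (3 * θ / 2) (π/2),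
      ENNReal.ofReal ((φ + θ) / (p.1 + p.2) ^ 3) ≤ 1 := by
  rw [Measure.volume_eq_prod, ← Measure.prod_restrict, lintegral_prod _ (by fun_prop)]
  have : ∀ a ∈ Ioo (3 * φ / 2) π, ∫⁻ b in Ioo (3 * θ / 2) (π/2), ENNReal.ofReal ((φ + θ) / (a + b) ^ 3)
      ≤ ENNReal.ofReal ((φ + θ) * (1 / (a + 3 * θ / 2) ^ 2)) := by
    intro a ha
    have e : ∀ b, ENNReal.ofReal ((φ + θ) / (a + b) ^ 3) =
        ENNReal.ofReal (φ + θ) * ENNReal.ofReal (1 / (a + b) ^ 3) := by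
      intro b; rw [← ENNReal.ofReal_mul h.le, mul_one_div]
    simp_rw [e]
    rw [lintegral_const_mul _ (by fun_prop), ENNReal.ofReal_mul h.le]
    gcongr
    exact lint_cube _ _ _ (by linarith [ha.1]) h2
  refine (setLIntegral_mono' measurableSet_Ioo this).trans ?_
  have := lint_ftc (g := fun a => - ((φ + θ) * (a + 3 * θ / 2)⁻¹)) (g' := fun a => (φ + θ) * (1 / (a + 3 * θ / 2) ^ 2)) h1
    (by
      apply ContinuousOn.neg
      apply ContinuousOn.mul (by fun_prop)
      apply ContinuousOn.inv₀ (by fun_prop)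
      intro x hx; have := hx.1; have : 0 < x + 3 * θ / 2 := by linarith
      positivity)
    (fun x hx => by
      have h0 : 0 < x + 3 * θ / 2 := by linarith [hx.1]
      have h := ((((hasDerivAt_id x).add_const (3 * θ / 2)).inv (by simp; positivity)).const_mul (φ + θ)).neg
      refine h.congr_deriv ?_
      simp only [id]
      field_simp)
    (fun x hx => by positivity)
  rw [this]
  rw [← ENNReal.ofReal_one]
  apply ENNReal.ofReal_le_ofReal
  have e1 : 0 < (π + 3 * θ / 2)⁻¹ := by positivity
  have e2 : (φ + θ) * (3 * φ / 2 + 3 * θ / 2)⁻¹ = 2 / 3 := by field_simp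
  nlinarith

lemma lint_I (φ θ : ℝ) (hφ : 0 ≤ φ) (hφ' : φ ≤ 1) (hθ : 0 < θ) (L : ℝ) (S : Set ℝ)
   (hS : ∀ x ∈ S, |x - θ| < L) (hL : 0 ≤ L) :
    ∫⁻ p in Ioo 0 π ×ˢ S,
      ENNReal.ofReal (1 / (√|p.1 - φ| * (|p.1 - φ| + θ)) * (1 / √|p.2 - θ|)) ≤
      ENNReal.ofReal (32 * √L / √θ) := by
  rw [Measure.volume_eq_prod, ← Measure.prod_restrict]
  have e : ∀ p : ℝ × ℝ, ENNReal.ofReal (1 / (√|p.1 - φ| * (|p.1 - φ| + θ)) * (1 / √|p.2 - θ|)) =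
     ENNReal.ofReal (1 / (√|p.1 - φ| * (|p.1 - φ| + θ))) * ENNReal.ofReal (1 / √|p.2 - θ|) := by
    intro p; rw [ENNReal.ofReal_mul (by positivity)]
  simp_rw [e]
  rw [lintegral_prod_mul (f := fun a => ENNReal.ofReal (1 / (√|a - φ| * (|a - φ| + θ))))
    (g := fun b => ENNReal.ofReal (1 / √|b - θ|)) (by fun_prop) (by fun_prop)]
  have h1 := lint_abs (fun x => ENNReal.ofReal (1 / (√x * (x + θ)))) 4 φ (Ioo 0 π)
    (by intro x hx; rw [abs_lt]; constructor <;> linarith [hx.1, hx.2, pi_lt_four])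
  have h2 := lint_abs (fun x => ENNReal.ofReal (1 / √x)) L θ S hS
  rw [lint_inv_sqrt _ hL] at h2
  have h3 := h1.trans (mul_le_mul_right (lint_arctan_sqrt 4 θ (by norm_num) hθ) 2)
  refine (mul_le_mul' h3 h2).trans ?_
  rw [← ENNReal.ofReal_ofNat, ← ENNReal.ofReal_mul (by norm_num), ← ENNReal.ofReal_mul (by norm_num),
    ← ENNReal.ofReal_mul (by positivity)]
  apply ENNReal.ofReal_le_ofReal
  apply le_of_eq
  ring

lemma lint_II_log (φ θ : ℝ) (hφ : 0 ≤ φ) (hθ : 0 < θ) (h2 : 3 * θ / 2 ≤ π / 2) :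
    ∫⁻ p in Ioo 0 (3 * φ / 2) ×ˢ Ioo (3 * θ / 2) (π/2),
      ENNReal.ofReal (1 / ((p.1 - φ) ^ 2 + p.2 ^ 2)) ≤ ENNReal.ofReal (8 * log (1 + φ / θ)) := by
  rw [Measure.volume_eq_prod, ← Measure.prod_restrict, lintegral_prod_symm _ (by fun_prop)]
  have hk : 0 < 3 * θ / 2 := by positivity
  refine (setLIntegral_mono' measurableSet_Ioo
    (fun b hb => lint_cauchy3 φ b hφ (hk.trans hb.1))).trans ?_
  simp_rw [ENNReal.ofReal_mul (show (0:ℝ) ≤ 8 by norm_num)]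
  rw [lintegral_const_mul _ (by fun_prop)]
  gcongr
  refine (lint_log φ _ _ hφ hk h2).trans (ENNReal.ofReal_le_ofReal ?_)
  apply log_le_log (by positivity)
  gcongr
  linarith

lemma lint_II_lip (φ θ : ℝ) (M W : ℝ) (hM : 0 ≤ M) (hW : 0 ≤ W) (hφ : 0 < φ) (hφ1 : φ ≤ 1) (hθ : 0 < θ) :
    ∫⁻ p in Ioo 0 (3 * φ / 2) ×ˢ Ioo (3 * θ / 2) (π/2),
      ENNReal.ofReal ((if p.2 ≤ 3 * φ / 2 then M * p.2 else W) * (1 / ((p.1 - φ) ^ 2 + p.2 ^ 2))) ≤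
      ENNReal.ofReal (6 * (W + M * φ)) := by
  have hm : Measurable fun p : ℝ × ℝ => ENNReal.ofReal ((if p.2 ≤ 3 * φ / 2 then M * p.2 else W) * (1 / ((p.1 - φ) ^ 2 + p.2 ^ 2))) := by
    apply Measurable.ennreal_ofReal
    apply Measurable.mul _ (by fun_prop)
    exact Measurable.ite (measurableSet_le (by fun_prop) (by fun_prop)) (by fun_prop) (by fun_prop)
  rw [Measure.volume_eq_prod, ← Measure.prod_restrict, lintegral_prod_symm _ hm.aemeasurable]
  have hk : 0 < 3 * θ / 2 := by positivity
  have hpi := pi_gt_three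
  set F : ℝ → ℝ≥0∞ := fun b => ∫⁻ a in Ioo 0 (3 * φ / 2),
    ENNReal.ofReal ((if b ≤ 3 * φ / 2 then M * b else W) * (1 / ((a - φ) ^ 2 + b ^ 2)))
  change ∫⁻ b in Ioo (3 * θ / 2) (π/2), F b ≤ _
  have hF : ∀ b > 0, F b = ENNReal.ofReal (if b ≤ 3 * φ / 2 then M * b else W) *
      ∫⁻ a in Ioo 0 (3 * φ / 2), ENNReal.ofReal (1 / ((a - φ) ^ 2 + b ^ 2)) := by
    intro b hb
    rw [← lintegral_const_mul _ (by fun_prop)]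
    refine lintegral_congr fun a => ?_
    rw [ENNReal.ofReal_mul]
    split_ifs <;> positivity
  have hsub : Ioo (3 * θ / 2) (π/2) ⊆ (Ioo 0 (3 * φ / 2) ∪ Ioo (3 * φ / 2) (π / 2)) ∪ {3 * φ / 2} := by
    intro x hx
    have hx1 := hx.1
    rcases lt_trichotomy x (3 * φ / 2) with h | h | h
    · exact Or.inl (Or.inl ⟨by linarith, h⟩)
    · exact Or.inr h
    · exact Or.inl (Or.inr ⟨h, hx.2⟩)
  refine (lintegral_mono_set hsub).trans ((lintegral_union_le _ _ _).trans ?_)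
  have h3 : ∫⁻ x in {3 * φ / 2}, F x = 0 := by simp
  rw [h3, add_zero]
  refine (lintegral_union_le _ _ _).trans ?_
  have t1 : ∫⁻ b in Ioo 0 (3 * φ / 2), F b ≤ ENNReal.ofReal (6 * (M * φ)) := by
    have : ∀ b ∈ Ioo 0 (3 * φ / 2), F b ≤ ENNReal.ofReal (4 * M) := by
      intro b hb
      rw [hF b hb.1, if_pos hb.2.le]
      refine (mul_le_mul_right (lint_cauchy _ _ _ _ (by positivity) hb.1) _).trans ?_
      rw [← ENNReal.ofReal_mul (mul_nonneg hM hb.1.le)]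
      apply ENNReal.ofReal_le_ofReal
      have := hb.1
      apply le_of_eq; field_simp
    refine (setLIntegral_mono' measurableSet_Ioo this).trans ?_
    rw [lint_const _ _ _ (by positivity) (by positivity)]
    apply ENNReal.ofReal_le_ofReal; apply le_of_eq; ring
  have t2 : ∫⁻ b in Ioo (3 * φ / 2) (π / 2), F b ≤ ENNReal.ofReal (6 * W) := by
    have : ∀ b ∈ Ioo (3 * φ / 2) (π / 2), F b ≤ ENNReal.ofReal (W * (3 / 2)) * ENNReal.ofReal (φ / b ^ 2) := by
      intro b hb
      have hb0 : 0 < b := by linarith [hb.1]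
      rw [hF b hb0, if_neg (not_le.2 hb.1)]
      refine (mul_le_mul_right (lint_cauchy2 _ _ hφ.le hb0) _).trans ?_
      rw [← ENNReal.ofReal_mul (by positivity), ← ENNReal.ofReal_mul (by positivity)]
      apply ENNReal.ofReal_le_ofReal
      apply le_of_eq; ring
    refine (setLIntegral_mono' measurableSet_Ioo this).trans ?_
    rw [lintegral_const_mul _ (by fun_prop)]
    refine (mul_le_mul_right (lint_sqinv _ _ _ hφ.le (by positivity) (by linarith)) _).trans ?_
    rw [← ENNReal.ofReal_mul (by positivity)]
    apply ENNReal.ofReal_le_ofReal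
    have : φ / (3 * φ / 2) = 2 / 3 := by field_simp
    rw [this]; linarith
  refine (add_le_add t1 t2).trans ?_
  rw [← ENNReal.ofReal_add (by positivity) (by positivity)]
  apply ENNReal.ofReal_le_ofReal; apply le_of_eq; ring

lemma one_sub_cos_ge {s : ℝ} (h : |s| ≤ π) : s ^ 2 / 5 ≤ 1 - cos s := by
  have h1 := cos_le_one_sub_mul_cos_sq h
  have h2 : (1:ℝ) / 5 ≤ 2 / π ^ 2 := by
    rw [div_le_div_iff₀ (by norm_num) (by positivity)]
    nlinarith [pi_lt_d2, pi_pos]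
  nlinarith [mul_le_mul_of_nonneg_right h2 (sq_nonneg s)]

lemma dist_ge {φ θ a b : ℝ} (hφ : φ ∈ Icc (0:ℝ) 1) (hθ : θ ∈ Icc (0:ℝ) 1) (ha : a ∈ Icc 0 π)
    (hb : |b| ≤ π / 2) : 1 / 200 * ((a - φ) ^ 2 + (b - θ) ^ 2) ≤ ‖sc φ θ - sc a b‖ ^ 2 := by
  rw [dist_sc]
  have hp3 := pi_gt_three
  have hp4 := pi_lt_d2
  obtain ⟨b1, b2⟩ := abs_le.1 hb
  have h1 : (θ - b) ^ 2 / 5 ≤ 1 - cos (θ - b) :=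
    one_sub_cos_ge (abs_le.2 ⟨by linarith [hθ.1], by linarith [hθ.2]⟩)
  have h2 : (φ - a) ^ 2 / 5 ≤ 1 - cos (φ - a) :=
    one_sub_cos_ge (abs_le.2 ⟨by linarith [hφ.1, ha.2], by linarith [hφ.2, ha.1]⟩)
  have hc1 : 1 / 2 ≤ cos θ := by
    have := one_sub_sq_div_two_le_cos (x := θ)
    nlinarith [hθ.1, hθ.2]
  have hc0 : 0 ≤ cos b := cos_nonneg_of_mem_Icc ⟨b1, b2⟩
  by_cases h : |b| ≤ 3 / 2
  · have hc2 : 1 / 25 ≤ cos b := by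
      have := one_sub_mul_le_cos (abs_nonneg b) hb
      rw [cos_abs] at this
      have e : 2 / π * |b| ≤ 24 / 25 := by
        rw [div_mul_eq_mul_div, div_le_iff₀ pi_pos]
        have := pi_gt_d2
        linarith
      linarith
    have hcc : 1 / 50 ≤ cos θ * cos b := by nlinarith
    have := mul_le_mul hcc h2 (by positivity) (by positivity)
    nlinarith [sq_nonneg (a - φ), sq_nonneg (b - θ)]
  · have ht : 1 / 4 ≤ (θ - b) ^ 2 := by
      push Not at h
      rcases lt_abs.1 h with h | h
      · nlinarith [hθ.2]
      · nlinarith [hθ.1]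
    have hs : (a - φ) ^ 2 ≤ 10 := by
      have e1 : a - φ ≤ 3.15 := by linarith [hφ.1, ha.2]
      have e2 : -3.15 ≤ a - φ := by linarith [hφ.2, ha.1]
      nlinarith
    have hcc : 0 ≤ (cos θ * cos b) * (1 - cos (φ - a)) :=
      mul_nonneg (mul_nonneg (by linarith) hc0) (by linarith [cos_le_one (φ - a)])
    nlinarith

def Kf (x y : E3) : ℝ :=
  (x 0 * y 1 - x 1 * y 0) / (‖x - y‖ ^ 2 * ‖x - flip3 y‖ ^ 2) +
    (x 0 * y 1 + x 1 * y 0) / (‖x - flip2 y‖ ^ 2 * ‖x - flip23 y‖ ^ 2)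

lemma nsq3 (x y : E3) : ‖x - flip3 y‖ ^ 2 = ‖x - y‖ ^ 2 + 4 * (x 2 * y 2) := by
  rw [nsq_sub, nsq_sub]; simp only [flip3, vec3_0, vec3_1, vec3_2]; ring
lemma nsq2 (x y : E3) : ‖x - flip2 y‖ ^ 2 = ‖x - y‖ ^ 2 + 4 * (x 1 * y 1) := by
  rw [nsq_sub, nsq_sub]; simp only [flip2, vec3_0, vec3_1, vec3_2]; ring
lemma nsq23 (x y : E3) : ‖x - flip23 y‖ ^ 2 = ‖x - y‖ ^ 2 + 4 * (x 1 * y 1) + 4 * (x 2 * y 2) := by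
  rw [nsq_sub, nsq_sub]; simp only [flip23, flip2, flip3, vec3_0, vec3_1, vec3_2]; ring

lemma N_le (x y : E3) (hx : x ∈ S2) : (x 0 * y 1 - x 1 * y 0) ^ 2 ≤ ‖x - y‖ ^ 2 := by
  rw [nsq_sub]
  rw [mem_S2] at hx
  have e : (x 0 * y 1 - x 1 * y 0) ^ 2 + (x 0 * (x 0 - y 0) + x 1 * (x 1 - y 1)) ^ 2
    = (x 0 ^ 2 + x 1 ^ 2) * ((x 0 - y 0) ^ 2 + (x 1 - y 1) ^ 2) := by ring
  have h1 : x 0 ^ 2 + x 1 ^ 2 ≤ 1 := by nlinarith [sq_nonneg (x 2)]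
  nlinarith [sq_nonneg (x 0 * (x 0 - y 0) + x 1 * (x 1 - y 1)), sq_nonneg (x 0 - y 0), sq_nonneg (x 1 - y 1), sq_nonneg (x 2 - y 2)]

lemma N_le' (x y : E3) (hx : x ∈ S2) : (x 0 * y 1 + x 1 * y 0) ^ 2 ≤ ‖x - flip2 y‖ ^ 2 := by
  have := N_le x (flip2 y) hx
  simp only [flip2, vec3_0, vec3_1] at this ⊢
  calc _ = (x 0 * -y 1 - x 1 * y 0) ^ 2 := by ring
    _ ≤ _ := this

lemma frac_le {N n B m C : ℝ} (hN : N ^ 2 ≤ n ^ 2) (hm : 0 < m) (hmn : m ≤ n) (hC : 0 < C) (hCB : C ≤ B) :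
    |N / (n ^ 2 * B)| ≤ 1 / (m * C) := by
  have hn : 0 < n := by linarith
  have hB : 0 < B := by linarith
  have h1 : |N| ≤ n := abs_le_of_sq_le_sq hN hn.le
  rw [abs_div, abs_of_pos (by positivity : 0 < n ^ 2 * B)]
  calc |N| / (n ^ 2 * B) ≤ n / (n ^ 2 * B) := by gcongr
    _ = 1 / (n * B) := by field_simp
    _ ≤ 1 / (m * C) := by gcongr

lemma K_le (x y : E3) (hx : x ∈ S2) (hx1 : 0 ≤ x 1) (hx2 : 0 ≤ x 2) (hy1 : 0 ≤ y 1) (hy2 : 0 ≤ y 2)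
    {m C : ℝ} (hm : 0 < m) (hmn : m ≤ ‖x - y‖) (hC : 0 < C) (hCB : C ≤ ‖x - flip3 y‖ ^ 2) :
    |Kf x y| ≤ 2 * (1 / (m * C)) := by
  have h11 := mul_nonneg hx1 hy1
  have e2 := nsq2 x y
  have h1 : ‖x - y‖ ≤ ‖x - flip2 y‖ := by
    apply le_of_sq_le_sq _ (norm_nonneg _)
    linarith
  have h2 : ‖x - flip3 y‖ ^ 2 ≤ ‖x - flip23 y‖ ^ 2 := by rw [nsq3, nsq23]; linarith
  have f1 := frac_le (N_le x y hx) hm hmn hC hCB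
  have f2 := frac_le (N_le' x y hx) hm (hmn.trans h1) hC (hCB.trans h2)
  unfold Kf
  refine (abs_add_le _ _).trans ?_
  linarith

def Ff (x : E3) (ω : E3 → ℝ) (y : E3) : ℝ := (‖x - y‖ ^ 2)⁻¹ * (ω y * (x 0 * y 1 - x 1 * y 0))

lemma fold_id (x y : E3) (ω : E3 → ℝ) (ho : OddOdd ω) (hx : x ∈ S2) (hx1 : 0 ≤ x 1) (hx2 : 0 ≤ x 2)
    (hy : y ∈ S2q) :
    Ff x ω y + Ff x ω (flip2 y) + Ff x ω (flip3 y) + Ff x ω (flip23 y) =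
      4 * x 2 * (y 2 * Kf x y * ω y) := by
  obtain ⟨hyS, hy1, hy2⟩ := hy
  have h3S : flip3 y ∈ S2 := by
    rw [mem_S2] at hyS ⊢; simpa [flip3] using hyS
  have o2 := (ho y hyS).1
  have o3 := (ho y hyS).2
  have o23 : ω (flip23 y) = ω y := by
    rw [flip23, (ho _ h3S).1, o3]; ring
  have n2 := nsq2 x y
  have n3 := nsq3 x y
  have n23 := nsq23 x y
  have hN := N_le x y hx
  have hN' := N_le' x y hx
  unfold Ff Kf
  rw [o2, o3, o23]
  have c2 : x 0 * (flip2 y) 1 - x 1 * (flip2 y) 0 = - (x 0 * y 1 + x 1 * y 0) := by simp [flip2]; ring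
  have c3 : x 0 * (flip3 y) 1 - x 1 * (flip3 y) 0 = x 0 * y 1 - x 1 * y 0 := by simp [flip3]
  have c23 : x 0 * (flip23 y) 1 - x 1 * (flip23 y) 0 = - (x 0 * y 1 + x 1 * y 0) := by simp [flip23, flip2, flip3]; ring
  rw [c2, c3, c23]
  have p11 := mul_nonneg hx1 hy1.le
  have p22 := mul_nonneg hx2 hy2.le
  have hA := sq_nonneg ‖x - y‖
  generalize ‖x - flip2 y‖ ^ 2 = A' at *
  generalize ‖x - flip3 y‖ ^ 2 = B at *
  generalize ‖x - flip23 y‖ ^ 2 = B' at *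
  generalize ‖x - y‖ ^ 2 = A at *
  generalize x 0 * y 1 - x 1 * y 0 = N at *
  generalize x 0 * y 1 + x 1 * y 0 = N' at *
  have t1 : A⁻¹ * N - B⁻¹ * N = 4 * (x 2 * y 2) * (N / (A * B)) := by
    by_cases h0 : A = 0
    · have : N = 0 := by rw [h0] at hN; exact pow_eq_zero_iff (two_ne_zero) |>.1 (le_antisymm hN (sq_nonneg _))
      simp [this]
    · have hA0 : 0 < A := lt_of_le_of_ne hA (Ne.symm h0)
      have hB0 : 0 < B := by linarith
      have : 4 * (x 2 * y 2) = B - A := by linarith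
      rw [this]; field_simp
  have t2 : A'⁻¹ * N' - B'⁻¹ * N' = 4 * (x 2 * y 2) * (N' / (A' * B')) := by
    by_cases h0 : A' = 0
    · have : N' = 0 := by rw [h0] at hN'; exact pow_eq_zero_iff (two_ne_zero) |>.1 (le_antisymm hN' (sq_nonneg _))
      simp [this]
    · have hA0 : 0 < A' := lt_of_le_of_ne (by linarith) (Ne.symm h0)
      have hB0 : 0 < B' := by linarith
      have : 4 * (x 2 * y 2) = B' - A' := by linarith
      rw [this]; field_simp
  linear_combination ω y * t1 + ω y * t2

lemma flip3_sc (a b : ℝ) : flip3 (sc a b) = sc a (-b) := by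
  apply E3_ext <;> simp [flip3, sc]
lemma flip2_sc (a b : ℝ) : flip2 (sc a b) = sc (-a) b := by
  apply E3_ext <;> simp [flip2, sc]
lemma flip23_sc (a b : ℝ) : flip23 (sc a b) = sc (-a) (-b) := by
  rw [flip23, flip3_sc, flip2_sc]
lemma x0_sc : x₀ = sc 0 0 := by
  apply E3_ext <;> simp [x₀, sc]

lemma sc_nonneg {a b : ℝ} (ha : a ∈ Icc 0 π) (hb : b ∈ Icc 0 (π/2)) :
    0 ≤ sc a b 1 ∧ 0 ≤ sc a b 2 ∧ sc a b 1 ≤ a ∧ sc a b 2 ≤ b := by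
  have hs := sin_nonneg_of_nonneg_of_le_pi ha.1 ha.2
  have hc : 0 ≤ cos b := cos_nonneg_of_mem_Icc ⟨by linarith [hb.1, pi_pos], hb.2⟩
  have hs' := sin_nonneg_of_nonneg_of_le_pi hb.1 (by linarith [hb.2, pi_pos])
  refine ⟨mul_nonneg hc hs, hs', ?_, sin_le hb.1⟩
  change cos b * sin a ≤ a
  have := sin_le ha.1
  nlinarith [cos_le_one b]

section
variable {φ θ a b : ℝ} (hφ : φ ∈ Icc (0:ℝ) 1) (hθ : θ ∈ Icc (0:ℝ) 1)
  (ha : a ∈ Icc 0 π) (hb : b ∈ Icc 0 (π/2))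
include hφ hθ ha hb

lemma distA_ge : 1 / 200 * ((a - φ) ^ 2 + (b - θ) ^ 2) ≤ ‖sc φ θ - sc a b‖ ^ 2 :=
  dist_ge hφ hθ ha (by rw [abs_of_nonneg hb.1]; exact hb.2)

lemma distB_ge : 1 / 200 * ((a - φ) ^ 2 + (b + θ) ^ 2) ≤ ‖sc φ θ - flip3 (sc a b)‖ ^ 2 := by
  rw [flip3_sc]
  have := dist_ge (b := -b) hφ hθ ha (by rw [abs_neg, abs_of_nonneg hb.1]; exact hb.2)
  calc _ = 1 / 200 * ((a - φ) ^ 2 + (-b - θ) ^ 2) := by ring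
    _ ≤ _ := this

lemma x_nonneg : 0 ≤ sc φ θ 1 ∧ 0 ≤ sc φ θ 2 ∧ sc φ θ 1 ≤ φ ∧ sc φ θ 2 ≤ θ :=
  sc_nonneg ⟨hφ.1, by linarith [hφ.2, pi_gt_three]⟩ ⟨hθ.1, by linarith [hθ.2, pi_gt_three]⟩

lemma norm_ge_sqrt : 1 / 15 * (√|a - φ| * √|b - θ|) ≤ ‖sc φ θ - sc a b‖ := by
  apply le_of_sq_le_sq _ (norm_nonneg _)
  refine le_trans ?_ (distA_ge hφ hθ ha hb)
  rw [mul_pow, mul_pow, sq_sqrt (abs_nonneg _), sq_sqrt (abs_nonneg _), ← sq_abs (a - φ), ← sq_abs (b - θ)]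
  nlinarith [sq_nonneg (|a - φ| - |b - θ|), sq_nonneg (|a - φ|), sq_nonneg (|b - θ|), abs_nonneg (a - φ), abs_nonneg (b - θ)]

lemma ptI (h0 : 0 < θ) (has : a ≠ φ) (hbt : b ≠ θ) (hbI : b ≤ 3 * θ / 2) :
    |sc a b 2 * Kf (sc φ θ) (sc a b)| ≤
      18000 * (1 / (√|a - φ| * (|a - φ| + θ)) * (1 / √|b - θ|)) := by
  obtain ⟨x1, x2, -, -⟩ := x_nonneg hφ hθ ha hb
  obtain ⟨y1, y2, -, y2'⟩ := sc_nonneg ha hb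
  have s0 : 0 < √|a - φ| := sqrt_pos.2 (abs_pos.2 (sub_ne_zero.2 has))
  have t0 : 0 < √|b - θ| := sqrt_pos.2 (abs_pos.2 (sub_ne_zero.2 hbt))
  have sp := abs_nonneg (a - φ)
  have hB : 1 / 400 * ((|a - φ| + θ) * θ) ≤ ‖sc φ θ - flip3 (sc a b)‖ ^ 2 := by
    refine le_trans ?_ (distB_ge hφ hθ ha hb)
    rw [← sq_abs (a - φ)]
    nlinarith [sq_nonneg (|a - φ| - θ), hb.1, mul_nonneg hb.1 h0.le, mul_nonneg sp h0.le, sq_nonneg b]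
  have := K_le (sc φ θ) (sc a b) (sc_mem _ _) x1 x2 y1 y2 (by positivity)
    (norm_ge_sqrt hφ hθ ha hb) (by positivity) hB
  rw [abs_mul, abs_of_nonneg y2]
  calc _ ≤ (3 * θ / 2) * (2 * (1 / (1 / 15 * (√|a - φ| * √|b - θ|) * (1 / 400 * ((|a - φ| + θ) * θ))))) := by
        gcongr; linarith
    _ = _ := by field_simp; norm_num

lemma ptII (h0 : 0 < b) (hbII : 3 * θ / 2 ≤ b) :
    |sc a b 2 * Kf (sc φ θ) (sc a b)| ≤ 18000 * (1 / ((a - φ) ^ 2 + b ^ 2)) := by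
  obtain ⟨x1, x2, -, -⟩ := x_nonneg hφ hθ ha hb
  obtain ⟨y1, y2, -, y2'⟩ := sc_nonneg ha hb
  have hA : b / 45 ≤ ‖sc φ θ - sc a b‖ := by
    apply le_of_sq_le_sq _ (norm_nonneg _)
    refine le_trans ?_ (distA_ge hφ hθ ha hb)
    nlinarith [sq_nonneg (a - φ)]
  have hB : 1 / 200 * ((a - φ) ^ 2 + b ^ 2) ≤ ‖sc φ θ - flip3 (sc a b)‖ ^ 2 := by
    refine le_trans ?_ (distB_ge hφ hθ ha hb)
    nlinarith [hθ.1, mul_nonneg h0.le hθ.1]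
  have := K_le (sc φ θ) (sc a b) (sc_mem _ _) x1 x2 y1 y2 (by positivity)
    hA (by positivity) hB
  rw [abs_mul, abs_of_nonneg y2]
  calc _ ≤ b * (2 * (1 / (b / 45 * (1 / 200 * ((a - φ) ^ 2 + b ^ 2))))) := by
        gcongr
    _ = _ := by field_simp; norm_num
end

lemma inv_diff {X Y R d ρ : ℝ} (hρ : 0 < ρ) (hd : 0 ≤ d) (hX : ρ ^ 2 / 3600 ≤ X) (hY : ρ ^ 2 / 3600 ≤ Y)
    (hR : ρ ^ 2 / 3600 ≤ R) (hX' : X ≤ 4 * ρ ^ 2) (hR' : R ≤ ρ ^ 2)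
    (hXR : |X - R| ≤ 3 * d * ρ) (hYR : |Y - R| ≤ 3 * d * ρ) :
    |1 / (X * Y) - 1 / R ^ 2| ≤ 15 * 3600 ^ 4 * d / ρ ^ 5 := by
  have hm : 0 < ρ ^ 2 / 3600 := by positivity
  have hX0 : 0 < X := by linarith
  have hY0 : 0 < Y := by linarith
  have hR0 : 0 < R := by linarith
  have e : 1 / (X * Y) - 1 / R ^ 2 = -(R * (X - R) + X * (Y - R)) / (X * Y * R ^ 2) := by
    field_simp; ring
  rw [e, abs_div, abs_neg, abs_of_pos (by positivity : 0 < X * Y * R ^ 2)]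
  have hn : |R * (X - R) + X * (Y - R)| ≤ 15 * d * ρ ^ 3 := by
    refine (abs_add_le _ _).trans ?_
    rw [abs_mul, abs_mul, abs_of_pos hR0, abs_of_pos hX0]
    have h1 := mul_le_mul hR' hXR (abs_nonneg _) (by positivity)
    have h2 := mul_le_mul hX' hYR (abs_nonneg _) (by positivity)
    calc _ ≤ ρ ^ 2 * (3 * d * ρ) + 4 * ρ ^ 2 * (3 * d * ρ) := add_le_add h1 h2
      _ = _ := by ring
  calc _ ≤ 15 * d * ρ ^ 3 / (ρ ^ 2 / 3600 * (ρ ^ 2 / 3600) * (ρ ^ 2 / 3600) ^ 2) := by gcongr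
    _ = _ := by field_simp

lemma inv_bd {X Y ρ : ℝ} (hρ : 0 < ρ) (hX : ρ ^ 2 / 3600 ≤ X) (hY : ρ ^ 2 / 3600 ≤ Y) :
    |1 / (X * Y)| ≤ 3600 ^ 2 / ρ ^ 4 := by
  have hm : 0 < ρ ^ 2 / 3600 := by positivity
  have hX0 : 0 < X := by linarith
  have hY0 : 0 < Y := by linarith
  rw [abs_of_pos (by positivity)]
  calc _ ≤ 1 / (ρ ^ 2 / 3600 * (ρ ^ 2 / 3600)) := by gcongr
    _ = _ := by field_simp

lemma norm_diff {x z y : E3} {d ρ : ℝ} (hd : ‖x - z‖ ≤ d) (hx : ‖x - y‖ ≤ 2 * ρ) (hz : ‖z - y‖ ≤ ρ) :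
    |‖x - y‖ ^ 2 - ‖z - y‖ ^ 2| ≤ 3 * d * ρ := by
  have h1 : |‖x - y‖ - ‖z - y‖| ≤ d := by
    refine (abs_norm_sub_norm_le _ _).trans ?_
    simpa using hd
  have e : ‖x - y‖ ^ 2 - ‖z - y‖ ^ 2 = (‖x - y‖ - ‖z - y‖) * (‖x - y‖ + ‖z - y‖) := by ring
  rw [e, abs_mul, abs_of_nonneg (by positivity : 0 ≤ ‖x - y‖ + ‖z - y‖)]
  have := mul_le_mul h1 (add_le_add hx hz) (by positivity) ((abs_nonneg _).trans h1)
  linarith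

def CF : ℝ := 31 * 3600 ^ 4

lemma far_alg {x0 x1 y0 y1 y2 u v w d ρ : ℝ} (hρ : 0 < ρ) (hd : 0 ≤ d)
    (hx0 : |x0| ≤ 1) (hx1 : |x1| ≤ d) (hy0 : |y0| ≤ 1) (hy1 : |y1| ≤ ρ) (hy2 : |y2| ≤ ρ)
    (hu : |u - w| ≤ 15 * 3600 ^ 4 * d / ρ ^ 5) (hv : |v - w| ≤ 15 * 3600 ^ 4 * d / ρ ^ 5)
    (hu' : |u| ≤ 3600 ^ 2 / ρ ^ 4) (hv' : |v| ≤ 3600 ^ 2 / ρ ^ 4) :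
    |y2 * ((x0 * y1 - x1 * y0) * u + (x0 * y1 + x1 * y0) * v) - 2 * x0 * (y1 * y2 * w)| ≤
      CF * (d / ρ ^ 3) := by
  have e : y2 * ((x0 * y1 - x1 * y0) * u + (x0 * y1 + x1 * y0) * v) - 2 * x0 * (y1 * y2 * w) =
    x0 * y1 * y2 * (u - w) + x0 * y1 * y2 * (v - w) + (-(x1 * y0 * y2) * u + x1 * y0 * y2 * v) := by ring
  rw [e]
  have a1 : |x0 * y1 * y2| ≤ 1 * ρ * ρ := by
    rw [abs_mul, abs_mul]; gcongr
  have a2 : |x1 * y0 * y2| ≤ d * 1 * ρ := by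
    rw [abs_mul, abs_mul]; gcongr
  have b1 : |x0 * y1 * y2 * (u - w)| ≤ (1 * ρ * ρ) * (15 * 3600 ^ 4 * d / ρ ^ 5) := by
    rw [abs_mul]; gcongr
  have b2 : |x0 * y1 * y2 * (v - w)| ≤ (1 * ρ * ρ) * (15 * 3600 ^ 4 * d / ρ ^ 5) := by
    rw [abs_mul]; gcongr
  have b3 : |-(x1 * y0 * y2) * u| ≤ (d * 1 * ρ) * (3600 ^ 2 / ρ ^ 4) := by
    rw [abs_mul, abs_neg]; gcongr
  have b4 : |x1 * y0 * y2 * v| ≤ (d * 1 * ρ) * (3600 ^ 2 / ρ ^ 4) := by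
    rw [abs_mul]; gcongr
  have c1 : (1 * ρ * ρ) * (15 * 3600 ^ 4 * d / ρ ^ 5) = 15 * 3600 ^ 4 * (d / ρ ^ 3) := by field_simp
  have c2 : (d * 1 * ρ) * (3600 ^ 2 / ρ ^ 4) = 3600 ^ 2 * (d / ρ ^ 3) := by field_simp
  rw [c1] at b1 b2
  rw [c2] at b3 b4
  have hp : 0 ≤ d / ρ ^ 3 := by positivity
  refine (abs_add_le _ _).trans ((add_le_add (abs_add_le _ _) (abs_add_le _ _)).trans ?_)
  unfold CF
  linarith

lemma abs_le_one_S2 {x : E3} (hx : x ∈ S2) : |x 0| ≤ 1 := by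
  rw [mem_S2] at hx
  apply abs_le_of_sq_le_sq _ (by norm_num)
  nlinarith [sq_nonneg (x 1), sq_nonneg (x 2)]

lemma ptQ {φ θ a b : ℝ} (hφ : φ ∈ Icc (0:ℝ) 1) (hθ : θ ∈ Icc (0:ℝ) 1)
    (ha : a ∈ Icc 0 π) (hb : b ∈ Icc 0 (π/2)) (haQ : 3 * φ / 2 < a) (hbQ : 3 * θ / 2 < b) :
    |sc a b 2 * Kf (sc φ θ) (sc a b) -
      2 * sc φ θ 0 * (sc a b 1 * sc a b 2 / ‖sc a b - x₀‖ ^ 4)| ≤ CF * ((φ + θ) / (a + b) ^ 3) := by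
  obtain ⟨x1, x2, x1', x2'⟩ := x_nonneg hφ hθ ha hb
  obtain ⟨y1, y2, y1', y2'⟩ := sc_nonneg ha hb
  have hφ0 := hφ.1
  have hθ0 := hθ.1
  set ρ := a + b with hρd
  have ha0 : 0 < a := by linarith
  have hb0 : 0 < b := by linarith
  have hρ : 0 < ρ := by linarith
  -- norms
  have hd : ‖sc φ θ - x₀‖ ≤ φ + θ := by
    apply le_of_sq_le_sq _ (by linarith)
    rw [x0_sc]
    refine (dist_sc_le _ _ _ _).trans ?_
    nlinarith [mul_nonneg hφ0 hθ0]
  have up : ∀ a' b', |a'| = a → |b'| = b → ‖sc φ θ - sc a' b'‖ ≤ 2 * ρ ∧ ‖x₀ - sc a' b'‖ ≤ ρ := by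
    intro a' b' h1 h2
    have i1 := le_abs_self a'
    have i2 := neg_abs_le a'
    have j1 := le_abs_self b'
    have j2 := neg_abs_le b'
    have k1 : a' ^ 2 = a ^ 2 := by rw [← h1, sq_abs]
    have k2 : b' ^ 2 = b ^ 2 := by rw [← h2, sq_abs]
    rw [h1] at i1 i2; rw [h2] at j1 j2
    constructor
    · apply le_of_sq_le_sq _ (by linarith)
      refine (dist_sc_le _ _ _ _).trans ?_
      nlinarith [mul_nonneg ha0.le hb0.le]
    · apply le_of_sq_le_sq _ (by linarith)
      rw [x0_sc]
      refine (dist_sc_le _ _ _ _).trans ?_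
      nlinarith [mul_nonneg ha0.le hb0.le]
  have aa := abs_of_pos ha0
  have bb := abs_of_pos hb0
  have na : |-a| = a := by rw [abs_neg, aa]
  have nb : |-b| = b := by rw [abs_neg, bb]
  have zR : ∀ z : E3, z = flip2 (sc a b) ∨ z = flip3 (sc a b) ∨ z = flip23 (sc a b) →
      ‖x₀ - z‖ ^ 2 = ‖x₀ - sc a b‖ ^ 2 := by
    rintro z (rfl | rfl | rfl)
    · rw [nsq2]; simp [x₀]
    · rw [nsq3]; simp [x₀]
    · rw [nsq23]; simp [x₀]
  have dA := norm_diff hd (up a b aa bb).1 (up a b aa bb).2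
  have uB := up a (-b) aa nb
  rw [← flip3_sc] at uB
  have dB := norm_diff hd uB.1 uB.2
  rw [zR _ (Or.inr (Or.inl rfl))] at dB
  have uA' := up (-a) b na bb
  rw [← flip2_sc] at uA'
  have dA' := norm_diff hd uA'.1 uA'.2
  rw [zR _ (Or.inl rfl)] at dA'
  have uB' := up (-a) (-b) na nb
  rw [← flip23_sc] at uB'
  have dB' := norm_diff hd uB'.1 uB'.2
  rw [zR _ (Or.inr (Or.inr rfl))] at dB'
  have lA : ρ ^ 2 / 3600 ≤ ‖sc φ θ - sc a b‖ ^ 2 := by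
    refine le_trans ?_ (distA_ge hφ hθ ha hb)
    have e1 : (a / 3) ^ 2 ≤ (a - φ) ^ 2 := by apply pow_le_pow_left₀ (by positivity); linarith
    have e2 : (b / 3) ^ 2 ≤ (b - θ) ^ 2 := by apply pow_le_pow_left₀ (by positivity); linarith
    nlinarith [sq_nonneg (a - b)]
  have lR : ρ ^ 2 / 3600 ≤ ‖x₀ - sc a b‖ ^ 2 := by
    rw [x0_sc]
    refine le_trans ?_ (distA_ge (φ := 0) (θ := 0) (by simp) (by simp) ha hb)
    nlinarith [sq_nonneg (a - b), sq_nonneg a, sq_nonneg b]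
  have p11 := mul_nonneg x1 y1
  have p22 := mul_nonneg x2 y2
  have lB : ρ ^ 2 / 3600 ≤ ‖sc φ θ - flip3 (sc a b)‖ ^ 2 := by rw [nsq3]; linarith
  have lA' : ρ ^ 2 / 3600 ≤ ‖sc φ θ - flip2 (sc a b)‖ ^ 2 := by rw [nsq2]; linarith
  have lB' : ρ ^ 2 / 3600 ≤ ‖sc φ θ - flip23 (sc a b)‖ ^ 2 := by rw [nsq23]; linarith
  have hA4 : ‖sc φ θ - sc a b‖ ^ 2 ≤ 4 * ρ ^ 2 := by
    have := pow_le_pow_left₀ (norm_nonneg _) (up a b aa bb).1 2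
    linarith
  have hA4' : ‖sc φ θ - flip2 (sc a b)‖ ^ 2 ≤ 4 * ρ ^ 2 := by
    have := pow_le_pow_left₀ (norm_nonneg _) uA'.1 2
    linarith
  have hR1 : ‖x₀ - sc a b‖ ^ 2 ≤ ρ ^ 2 := pow_le_pow_left₀ (norm_nonneg _) (up a b aa bb).2 2
  have hd0 : 0 ≤ φ + θ := by linarith
  have hu := inv_diff hρ hd0 lA lB lR hA4 hR1 dA dB
  have hv := inv_diff hρ hd0 lA' lB' lR hA4' hR1 dA' dB'
  have hu' := inv_bd hρ lA lB
  have hv' := inv_bd hρ lA' lB'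
  have := far_alg (x0 := sc φ θ 0) (x1 := sc φ θ 1) (y0 := sc a b 0) (y1 := sc a b 1) (y2 := sc a b 2) hρ hd0
    (abs_le_one_S2 (sc_mem _ _)) (by rw [abs_of_nonneg x1]; linarith) (abs_le_one_S2 (sc_mem _ _))
    (by rw [abs_of_nonneg y1]; linarith) (by rw [abs_of_nonneg y2]; linarith) hu hv hu' hv'
  refine le_trans (le_of_eq ?_) this
  unfold Kf
  rw [norm_sub_rev (sc a b) x₀]
  congr 1
  ring

lemma lint_prod_sqrt (φ θ : ℝ) (hφ : φ ∈ Icc (0:ℝ) 1) (hθ : θ ∈ Icc (0:ℝ) 1) :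
    ∫⁻ p in Dq, ENNReal.ofReal (1 / √|p.1 - φ|) * ENNReal.ofReal (1 / √|p.2 - θ|) < ⊤ := by
  have hpi := pi_le_four
  have hpi0 := pi_pos
  rw [Dq, Measure.volume_eq_prod, ← Measure.prod_restrict,
    lintegral_prod_mul (f := fun a => ENNReal.ofReal (1 / √|a - φ|))
      (g := fun b => ENNReal.ofReal (1 / √|b - θ|)) (by fun_prop) (by fun_prop)]
  apply ENNReal.mul_lt_top
  · refine (lint_abs (fun x => ENNReal.ofReal (1 / √x)) 5 φ _ ?_).trans_lt ?_
    · rintro x ⟨h1, h2⟩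
      rw [abs_lt]; constructor <;> linarith [hφ.1, hφ.2]
    · rw [lint_inv_sqrt 5 (by norm_num)]
      exact ENNReal.mul_lt_top (by simp) ENNReal.ofReal_lt_top
  · refine (lint_abs (fun x => ENNReal.ofReal (1 / √x)) 5 θ _ ?_).trans_lt ?_
    · rintro x ⟨h1, h2⟩
      rw [abs_lt]; constructor <;> linarith [hθ.1, hθ.2]
    · rw [lint_inv_sqrt 5 (by norm_num)]
      exact ENNReal.mul_lt_top (by simp) ENNReal.ofReal_lt_top

lemma ae_ne (φ θ : ℝ) : ∀ᵐ p : ℝ × ℝ, p.1 ≠ φ ∧ p.2 ≠ θ := by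
  have h1 : ∀ᵐ p : ℝ × ℝ, p.1 ≠ φ := by
    rw [ae_iff]; simpa using line_null φ
  have h2 : ∀ᵐ p : ℝ × ℝ, p.2 ≠ θ := by
    rw [ae_iff]; simpa using line_null' θ
  filter_upwards [h1, h2] with p a b using ⟨a, b⟩

lemma inv_dist_sgq (φ θ : ℝ) (hφ : φ ∈ Icc (0:ℝ) 1) (hθ : θ ∈ Icc (0:ℝ) 1) :
    ∫⁻ y, ENNReal.ofReal (‖sc φ θ - y‖⁻¹) ∂sgq < ⊤ := by
  refine (lint_sgq_le _ (by fun_prop)).trans_lt (ENNReal.mul_lt_top (by simp) ?_)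
  have h : ∫⁻ p in Dq, ENNReal.ofReal (‖sc φ θ - scp p‖⁻¹) ≤
      ∫⁻ p in Dq, 15 * (ENNReal.ofReal (1 / √|p.1 - φ|) * ENNReal.ofReal (1 / √|p.2 - θ|)) := by
    apply lintegral_mono_ae
    filter_upwards [ae_restrict_mem Dq_meas, ae_restrict_of_ae (ae_ne φ θ)] with p hp hne
    have e : (15 : ℝ≥0∞) = ENNReal.ofReal 15 := by simp
    rw [e, ← ENNReal.ofReal_mul (by positivity), ← ENNReal.ofReal_mul (by positivity)]
    apply ENNReal.ofReal_le_ofReal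
    have h1 : 0 < √|p.1 - φ| := sqrt_pos.2 (abs_pos.2 (sub_ne_zero.2 hne.1))
    have h2 : 0 < √|p.2 - θ| := sqrt_pos.2 (abs_pos.2 (sub_ne_zero.2 hne.2))
    have h3 := norm_ge_sqrt hφ hθ (Ioo_subset_Icc_self hp.1) (Ioo_subset_Icc_self hp.2)
    calc ‖sc φ θ - scp p‖⁻¹ ≤ (1 / 15 * (√|p.1 - φ| * √|p.2 - θ|))⁻¹ :=
          inv_anti₀ (by positivity) h3
      _ = _ := by field_simp
  refine h.trans_lt ?_
  rw [lintegral_const_mul _ (by fun_prop)]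
  exact ENNReal.mul_lt_top (by simp) (lint_prod_sqrt φ θ hφ hθ)

lemma inv_dist_sigma (φ θ : ℝ) (hφ : φ ∈ Icc (0:ℝ) 1) (hθ : θ ∈ Icc (0:ℝ) 1) :
    ∫⁻ y, ENNReal.ofReal (‖sc φ θ - y‖⁻¹) ∂sigma2 < ⊤ := by
  have hpi := pi_gt_three
  rw [fold_lint _ (by fun_prop)]
  have hI := inv_dist_sgq φ θ hφ hθ
  have hx := sc_nonneg (a := φ) (b := θ) ⟨hφ.1, by linarith [hφ.2]⟩ ⟨hθ.1, by linarith [hθ.2]⟩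
  have hae : ∀ᵐ y ∂sgq, y ∈ S2q := ae_restrict_mem S2q_meas
  have hsc : ∀ᵐ y ∂sgq, sc φ θ ≠ y := by
    have : (μH[2] : Measure E3) {sc φ θ} = 0 := by
      have := Measure.nullSingletonClass_hausdorff E3 (d := 2) (by norm_num)
      exact measure_singleton _
    have h2 : sgq {sc φ θ} = 0 := le_antisymm ((Measure.restrict_apply_le _ _).trans this.le) bot_le
    rw [ae_iff]
    convert h2 using 2
    ext y; simp [eq_comm]
  have key : ∀ f : E3 → E3, (∀ y ∈ S2q, ‖sc φ θ - y‖ ^ 2 ≤ ‖sc φ θ - f y‖ ^ 2) →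
      ∫⁻ y, ENNReal.ofReal (‖sc φ θ - f y‖⁻¹) ∂sgq < ⊤ := by
    intro f hf
    refine lt_of_le_of_lt (lintegral_mono_ae ?_) hI
    filter_upwards [hae, hsc] with y hy hne
    apply ENNReal.ofReal_le_ofReal
    apply inv_anti₀ (norm_pos_iff.2 (sub_ne_zero.2 hne))
    exact (sq_le_sq₀ (norm_nonneg _) (norm_nonneg _)).1 (hf y hy)
  refine ENNReal.add_lt_top.2 ⟨ENNReal.add_lt_top.2 ⟨ENNReal.add_lt_top.2 ⟨hI, ?_⟩, ?_⟩, ?_⟩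
  · apply key; intro y hy; rw [nsq2]; nlinarith [mul_nonneg hx.1 hy.2.1.le]
  · apply key; intro y hy; rw [nsq3]; nlinarith [mul_nonneg hx.2.1 hy.2.2.le]
  · apply key; intro y hy; rw [nsq23]; nlinarith [mul_nonneg hx.1 hy.2.1.le, mul_nonneg hx.2.1 hy.2.2.le]

lemma cross_le (x y : E3) (hx : x ∈ S2) (hy : y ∈ S2) : ‖cross3 x y‖ ≤ ‖x - y‖ := by
  apply (sq_le_sq₀ (norm_nonneg _) (norm_nonneg _)).1
  rw [nsq, nsq_sub]
  rw [mem_S2] at hx hy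
  simp only [cross3, vec3_0, vec3_1, vec3_2]
  have e : (x 1 * y 2 - x 2 * y 1) ^ 2 + (x 2 * y 0 - x 0 * y 2) ^ 2 + (x 0 * y 1 - x 1 * y 0) ^ 2
    = (x 0 ^ 2 + x 1 ^ 2 + x 2 ^ 2) * (y 0 ^ 2 + y 1 ^ 2 + y 2 ^ 2)
      - (x 0 * y 0 + x 1 * y 1 + x 2 * y 2) ^ 2 := by ring
  rw [e, hx, hy]
  nlinarith [sq_nonneg (x 0 * y 0 + x 1 * y 1 + x 2 * y 2 - 1)]

lemma cross_meas (x : E3) : Measurable (fun y => cross3 x y) := by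
  have h : Measurable (fun y : E3 => ![x 1 * y 2 - x 2 * y 1, x 2 * y 0 - x 0 * y 2, x 0 * y 1 - x 1 * y 0]) := by
    rw [measurable_pi_iff]
    intro i
    fin_cases i <;> simp <;> fun_prop
  exact (MeasurableEquiv.toLp 2 (Fin 3 → ℝ)).measurable.comp h

lemma bs_int (ω : E3 → ℝ) (W : ℝ) (hm : Measurable ω) (hW : ∀ y, |ω y| ≤ W) (φ θ : ℝ)
    (hφ : φ ∈ Icc (0:ℝ) 1) (hθ : θ ∈ Icc (0:ℝ) 1) :
    Integrable (fun y => (‖sc φ θ - y‖ ^ 2)⁻¹ • ω y • cross3 (sc φ θ) y) sigma2 := by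
  have hW0 : 0 ≤ W := (abs_nonneg _).trans (hW 0)
  have h1 : Integrable (fun y => W * ‖sc φ θ - y‖⁻¹) sigma2 := by
    apply Integrable.const_mul
    refine ⟨by fun_prop, ?_⟩
    rw [hasFiniteIntegral_iff_ofReal (Eventually.of_forall fun y => by positivity)]
    exact inv_dist_sigma φ θ hφ hθ
  refine h1.mono' ?_ ?_
  · have := cross_meas (sc φ θ)
    exact Measurable.aestronglyMeasurable (by fun_prop)
  · filter_upwards [ae_restrict_mem S2_meas] with y hy
    rw [norm_smul, norm_smul]
    have h2 := cross_le _ _ (sc_mem φ θ) hy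
    rw [norm_of_nonneg (by positivity : 0 ≤ (‖sc φ θ - y‖ ^ 2)⁻¹), Real.norm_eq_abs]
    rcases eq_or_lt_of_le (norm_nonneg (sc φ θ - y)) with h0 | h0
    · rw [← h0]; simp
    calc _ ≤ (‖sc φ θ - y‖ ^ 2)⁻¹ * (W * ‖sc φ θ - y‖) := by gcongr; exact hW y
      _ = _ := by field_simp

lemma dot_bs (ω : E3 → ℝ) (W : ℝ) (hm : Measurable ω) (hW : ∀ y, |ω y| ≤ W) (φ θ : ℝ)
    (hφ : φ ∈ Icc (0:ℝ) 1) (hθ : θ ∈ Icc (0:ℝ) 1) :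
    Integrable (Ff (sc φ θ) ω) sigma2 ∧
    dot3 (biotSavart ω (sc φ θ)) (etheta (sc φ θ)) =
      (2 * π)⁻¹ / √(1 - (sc φ θ 2) ^ 2) * ∫ y, Ff (sc φ θ) ω y ∂sigma2 := by
  have hpi := pi_gt_three
  have hI := bs_int ω W hm hW φ θ hφ hθ
  set x := sc φ θ with hx
  set V := fun y => (‖x - y‖ ^ 2)⁻¹ • ω y • cross3 x y with hV
  have hxs : x 0 ^ 2 + x 1 ^ 2 + x 2 ^ 2 = 1 := (mem_S2 _).1 (sc_mem φ θ)
  have hpos : 0 < 1 - x 2 ^ 2 := by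
    have : 0 < cos θ := cos_pos_of_mem_Ioo ⟨by linarith [hθ.1], by linarith [hθ.2]⟩
    have h2 : 1 - x 2 ^ 2 = cos θ ^ 2 := by
      rw [hx, sc, vec3_2]; nlinarith [sin_sq_add_cos_sq θ]
    rw [h2]; positivity
  have hs : 0 < √(1 - x 2 ^ 2) := sqrt_pos.2 hpos
  have hss : √(1 - x 2 ^ 2) ^ 2 = 1 - x 2 ^ 2 := sq_sqrt hpos.le
  set s := √(1 - x 2 ^ 2) with hs'
  have hc : ∀ i : Fin 3, Integrable (fun y => V y i) sigma2 ∧ (∫ y, V y ∂sigma2) i = ∫ y, V y i ∂sigma2 := by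
    intro i
    refine ⟨(EuclideanSpace.proj (𝕜 := ℝ) i).integrable_comp hI, ?_⟩
    exact ((EuclideanSpace.proj (𝕜 := ℝ) i).integral_comp_comm hI).symm
  have hVF : ∀ y, V y 0 * (-(x 2) * x 0) + V y 1 * (-(x 2) * x 1) + V y 2 * s ^ 2 = Ff x ω y := by
    intro y
    simp only [hV, Ff, PiLp.smul_apply, smul_eq_mul, cross3, vec3_0, vec3_1, vec3_2, hss]
    have : 1 - x 2 ^ 2 = x 0 ^ 2 + x 1 ^ 2 := by linarith
    have e : (x 1 * y 2 - x 2 * y 1) * (-(x 2) * x 0) + (x 2 * y 0 - x 0 * y 2) * (-(x 2) * x 1)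
       + (x 0 * y 1 - x 1 * y 0) * (1 - x 2 ^ 2) = x 0 * y 1 - x 1 * y 0 := by ring
    linear_combination (‖x - y‖ ^ 2)⁻¹ * ω y * e
  have hF : Ff x ω = fun y => V y 0 * (-(x 2) * x 0) + V y 1 * (-(x 2) * x 1) + V y 2 * s ^ 2 := by
    funext y; exact (hVF y).symm
  have i0 := (hc 0).1.mul_const (-(x 2) * x 0)
  have i1 := (hc 1).1.mul_const (-(x 2) * x 1)
  have i2 := (hc 2).1.mul_const (s ^ 2)
  constructor
  · rw [hF]; exact (i0.add i1).add i2
  · have : ∫ y, Ff x ω y ∂sigma2 = (∫ y, V y 0 ∂sigma2) * (-(x 2) * x 0) +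
        (∫ y, V y 1 ∂sigma2) * (-(x 2) * x 1) + (∫ y, V y 2 ∂sigma2) * s ^ 2 := by
      have e := integral_add (i0.add i1) i2
      have e' := integral_add i0 i1
      simp only [Pi.add_apply] at e
      rw [hF, ← integral_mul_const, ← integral_mul_const, ← integral_mul_const]
      exact e.trans (by rw [e'])
    rw [this, ← (hc 0).2, ← (hc 1).2, ← (hc 2).2]
    simp only [dot3, biotSavart, etheta, vec3_0, vec3_1, vec3_2, PiLp.smul_apply, smul_eq_mul]
    rw [← hs']
    simp only [← hV]
    field_simp

lemma Kf_meas (x : E3) : Measurable (Kf x) := by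
  unfold Kf
  have h2 := flip2_meas
  have h3 := flip3_meas
  have h23 := flip23_meas
  fun_prop

def gf (x : E3) (ω : E3 → ℝ) (y : E3) : ℝ := y 2 * Kf x y * ω y
def qf (ω : E3 → ℝ) (y : E3) : ℝ := y 1 * y 2 / ‖y - x₀‖ ^ 4 * ω y
def Hf (φ θ : ℝ) (ω : E3 → ℝ) (y : E3) : ℝ :=
  gf (sc φ θ) ω y - 2 * sc φ θ 0 * (Qset (3 * φ / 2) (3 * θ / 2)).indicator (qf ω) y

lemma gf_meas (x : E3) (ω : E3 → ℝ) (hm : Measurable ω) : Measurable (gf x ω) := by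
  unfold gf
  have := Kf_meas x
  fun_prop

lemma qf_meas (ω : E3 → ℝ) (hm : Measurable ω) : Measurable (qf ω) := by
  unfold qf
  fun_prop

lemma Hf_meas (φ θ : ℝ) (hφ : 0 ≤ φ) (hθ : 0 ≤ θ) (ω : E3 → ℝ) (hm : Measurable ω) :
    Measurable (Hf φ θ ω) := by
  unfold Hf
  exact (gf_meas _ ω hm).sub (((qf_meas ω hm).indicator (Q_meas (by positivity) (by positivity))).const_mul _)

lemma Ff_meas (x : E3) (ω : E3 → ℝ) (hm : Measurable ω) : Measurable (Ff x ω) := by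
  unfold Ff
  fun_prop

lemma sgq_fin : sgq univ < ⊤ := by
  have h := lint_sgq_le (fun _ => 1) measurable_const
  rw [lintegral_one, lintegral_one, Measure.restrict_apply_univ] at h
  refine h.trans_lt (ENNReal.mul_lt_top (by simp) ?_)
  rw [Dq, Measure.volume_eq_prod, Measure.prod_prod, Real.volume_Ioo, Real.volume_Ioo]
  exact ENNReal.mul_lt_top ENNReal.ofReal_lt_top ENNReal.ofReal_lt_top

lemma q_int (ω : E3 → ℝ) (W : ℝ) (hm : Measurable ω) (hW : ∀ y, |ω y| ≤ W) (φ θ : ℝ)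
    (hφ : 0 ≤ φ) (hθ : 0 < θ) : IntegrableOn (qf ω) (Qset (3 * φ / 2) (3 * θ / 2)) sgq := by
  have hW0 : 0 ≤ W := (abs_nonneg _).trans (hW 0)
  have hQ := Q_meas (k := 3 * φ / 2) (l := 3 * θ / 2) (by positivity) (by positivity)
  refine Measure.integrableOn_of_bounded (M := (1 / (1 / 200 * θ ^ 2) ^ 2) * W) ?_ ?_ ?_
  · exact ((measure_mono (subset_univ _)).trans_lt sgq_fin).ne
  · exact (qf_meas ω hm).aestronglyMeasurable
  · filter_upwards [ae_restrict_mem hQ] with y hy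
    obtain ⟨⟨a, b⟩, ⟨⟨ha1, ha2⟩, ⟨hb1, hb2⟩⟩, rfl⟩ := hy
    simp only at *
    have ha0 : 0 ≤ a := le_trans (by positivity) ha1.le
    have hb0 : 0 ≤ b := le_trans (by positivity) hb1.le
    have hd := distA_ge (φ := 0) (θ := 0) (a := a) (b := b) (by simp) (by simp) ⟨ha0, ha2.le⟩ ⟨hb0, hb2.le⟩
    rw [← x0_sc] at hd
    have hS := (mem_S2 _).1 (sc_mem a b)
    have h1 : |sc a b 1 * sc a b 2| ≤ 1 := by
      rw [abs_le]
      constructor <;> nlinarith [sq_nonneg (sc a b 1 - sc a b 2), sq_nonneg (sc a b 1 + sc a b 2), sq_nonneg (sc a b 0)]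
    have hd2 : 1 / 200 * θ ^ 2 ≤ ‖sc a b - x₀‖ ^ 2 := by
      rw [norm_sub_rev]
      refine le_trans ?_ hd
      have : θ ^ 2 ≤ b ^ 2 := by gcongr; linarith
      nlinarith [sq_nonneg a]
    rw [qf, norm_mul, norm_div, Real.norm_eq_abs, Real.norm_eq_abs, Real.norm_eq_abs,
      abs_of_nonneg (by positivity : 0 ≤ ‖sc a b - x₀‖ ^ 4)]
    have hd4 : (1 / 200 * θ ^ 2) ^ 2 ≤ ‖sc a b - x₀‖ ^ 4 := by
      calc _ ≤ (‖sc a b - x₀‖ ^ 2) ^ 2 := by gcongr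
        _ = _ := by ring
    gcongr
    exact hW _

lemma Q_integral (ω : E3 → ℝ) (φ θ : ℝ) (hφ : 0 ≤ φ) (hθ : 0 ≤ θ) :
    ∫ y in Qset (3 * φ / 2) (3 * θ / 2), qf ω y ∂sigma2 =
      ∫ y, (Qset (3 * φ / 2) (3 * θ / 2)).indicator (qf ω) y ∂sgq := by
  have hQ := Q_meas (k := 3 * φ / 2) (l := 3 * θ / 2) (by positivity) (by positivity)
  have hs := Q_sub_S2q (k := 3 * φ / 2) (l := 3 * θ / 2) (by positivity) (by positivity)
  rw [integral_indicator hQ, sigma2, sgq, Measure.restrict_restrict hQ, Measure.restrict_restrict hQ,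
    inter_eq_left.2 hs, inter_eq_left.2 (hs.trans fun y hy => hy.1)]

lemma main_id (ω : E3 → ℝ) (W : ℝ) (hm : Measurable ω) (hW : ∀ y, |ω y| ≤ W) (ho : OddOdd ω) (φ θ : ℝ)
    (hφ : φ ∈ Icc (0:ℝ) 1) (hθ : θ ∈ Icc (0:ℝ) 1) (h0 : 0 < θ) :
    dot3 (biotSavart ω (sc φ θ)) (etheta (sc φ θ)) -
      ((sc φ θ) 2 / sqrt (1 - ((sc φ θ) 2) ^ 2)) * ((4 * (sc φ θ) 0 / Real.pi) *
        ∫ y in Qset (3 * φ / 2) (3 * θ / 2), y 1 * y 2 / ‖y - x₀‖ ^ 4 * ω y ∂sigma2) =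
    ((sc φ θ) 2 / sqrt (1 - ((sc φ θ) 2) ^ 2)) * ((2 / π) * ∫ y, Hf φ θ ω y ∂sgq) := by
  have hpi := pi_gt_three
  obtain ⟨hI, hd⟩ := dot_bs ω W hm hW φ θ hφ hθ
  obtain ⟨hJ, hf⟩ := fold_int _ (Ff_meas (sc φ θ) ω hm) hI
  have hx := sc_nonneg (a := φ) (b := θ) ⟨hφ.1, by linarith [hφ.2]⟩ ⟨hθ.1, by linarith [hθ.2]⟩
  have hae : ∀ᵐ y ∂sgq, Ff (sc φ θ) ω y + Ff (sc φ θ) ω (flip2 y) + Ff (sc φ θ) ω (flip3 y)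
      + Ff (sc φ θ) ω (flip23 y) = 4 * sc φ θ 2 * gf (sc φ θ) ω y := by
    filter_upwards [ae_restrict_mem S2q_meas] with y hy
    exact fold_id _ y ω ho (sc_mem _ _) hx.1 hx.2.1 hy
  have hx2 : 0 < sc φ θ 2 := by
    rw [sc, vec3_2]; exact sin_pos_of_pos_of_lt_pi h0 (by linarith [hθ.2])
  have hg : Integrable (gf (sc φ θ) ω) sgq := by
    have := (hJ.congr hae).const_mul (4 * sc φ θ 2)⁻¹
    refine this.congr (Eventually.of_forall fun y => ?_)
    simp only
    field_simp
  have hq := (integrable_indicator_iff (Q_meas (k := 3 * φ / 2) (l := 3 * θ / 2)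
    (by linarith [hφ.1]) (by linarith))).2 (q_int ω W hm hW φ θ hφ.1 h0)
  rw [hd, hf, integral_congr_ae hae, integral_const_mul]
  have e2 := Q_integral ω φ θ hφ.1 h0.le
  simp only [qf] at e2
  rw [e2]
  simp only [Hf]
  rw [integral_sub hg (hq.const_mul _), integral_const_mul]
  field_simp
  ring

lemma main_zero (ω : E3 → ℝ) (W : ℝ) (hm : Measurable ω) (hW : ∀ y, |ω y| ≤ W) (ho : OddOdd ω) (φ : ℝ)
    (hφ : φ ∈ Icc (0:ℝ) 1) :
    dot3 (biotSavart ω (sc φ 0)) (etheta (sc φ 0)) = 0 := by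
  have hpi := pi_gt_three
  obtain ⟨hI, hd⟩ := dot_bs ω W hm hW φ 0 hφ (by simp)
  obtain ⟨hJ, hf⟩ := fold_int _ (Ff_meas (sc φ 0) ω hm) hI
  have hx := sc_nonneg (a := φ) (b := 0) ⟨hφ.1, by linarith [hφ.2]⟩ ⟨le_rfl, by linarith⟩
  have hae : ∀ᵐ y ∂sgq, Ff (sc φ 0) ω y + Ff (sc φ 0) ω (flip2 y) + Ff (sc φ 0) ω (flip3 y)
      + Ff (sc φ 0) ω (flip23 y) = 0 := by
    filter_upwards [ae_restrict_mem S2q_meas] with y hy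
    rw [fold_id _ y ω ho (sc_mem _ _) hx.1 hx.2.1 hy]
    simp [sc]
  rw [hd, hf, integral_congr_ae hae]
  simp

lemma H_bound (ω : E3 → ℝ) (W : ℝ) (hm : Measurable ω) (hW : ∀ y, |ω y| ≤ W) (φ θ : ℝ)
    (hφ : φ ∈ Icc (0:ℝ) 1) (hθ : θ ∈ Icc (0:ℝ) 1) (h0 : 0 < θ) (B : ℝ) (hB : 0 ≤ B)
    (hII : ∫⁻ p in Ioo 0 (3 * φ / 2) ×ˢ Ioo (3 * θ / 2) (π/2),
      ENNReal.ofReal (|ω (scp p)| * (1 / ((p.1 - φ) ^ 2 + p.2 ^ 2))) ≤ ENNReal.ofReal B) :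
    |∫ y, Hf φ θ ω y ∂sgq| ≤ 4 * ((CF * W + 18000 * 32 * W) + 18000 * B) := by
  have hpi := pi_gt_three
  have hW0 : 0 ≤ W := (abs_nonneg _).trans (hW 0)
  have hCF : 0 ≤ CF := by unfold CF; norm_num
  have hφ0 := hφ.1
  have hφ1 := hφ.2
  have hθ1 := hθ.2
  have hHm := Hf_meas φ θ hφ0 h0.le ω hm
  have hk : 0 ≤ 3 * φ / 2 := by positivity
  have hl : 0 ≤ 3 * θ / 2 := by positivity
  set F : ℝ × ℝ → ℝ≥0∞ := fun p => ENNReal.ofReal ‖Hf φ θ ω (scp p)‖ with hF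
  set DQ := Ioo (3 * φ / 2) π ×ˢ Ioo (3 * θ / 2) (π/2) with hDQ
  set DI := Ioo 0 π ×ˢ Ioc 0 (3 * θ / 2) with hDI
  set DII := Ioo 0 (3 * φ / 2) ×ˢ Ioo (3 * θ / 2) (π/2) with hDII
  have sQ : ∀ p ∈ DQ, p ∈ Dq := fun p hp => ⟨⟨hk.trans_lt hp.1.1, hp.1.2⟩, ⟨hl.trans_lt hp.2.1, hp.2.2⟩⟩
  have sI : ∀ p ∈ DI, p ∈ Dq := fun p hp => ⟨hp.1, ⟨hp.2.1, by linarith [hp.2.2]⟩⟩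
  have sII : ∀ p ∈ DII, p ∈ Dq := fun p hp => ⟨⟨hp.1.1, by linarith [hp.1.2]⟩, ⟨hl.trans_lt hp.2.1, hp.2.2⟩⟩
  have mQ : MeasurableSet DQ := measurableSet_Ioo.prod measurableSet_Ioo
  have mI : MeasurableSet DI := measurableSet_Ioo.prod measurableSet_Ioc
  have mII : MeasurableSet DII := measurableSet_Ioo.prod measurableSet_Ioo
  have hout : ∀ p ∈ Dq, ¬ (3 * φ / 2 < p.1 ∧ 3 * θ / 2 < p.2) →
      ‖Hf φ θ ω (scp p)‖ = |scp p 2 * Kf (sc φ θ) (scp p)| * |ω (scp p)| := by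
    intro p hp hn
    rw [Hf, indicator_of_notMem (fun h => hn ((scp_mem_Q hk hl hp).1 h)), gf, mul_zero, sub_zero,
      Real.norm_eq_abs, abs_mul]
  have bQ : ∫⁻ p in DQ, F p ≤ ENNReal.ofReal (CF * W) := by
    calc ∫⁻ p in DQ, F p ≤ ∫⁻ p in DQ, ENNReal.ofReal (CF * W) * ENNReal.ofReal ((φ + θ) / (p.1 + p.2) ^ 3) := by
          refine setLIntegral_mono' mQ fun p hp => ?_
          rw [hF, ← ENNReal.ofReal_mul (by positivity)]
          apply ENNReal.ofReal_le_ofReal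
          have hp' := sQ p hp
          have h1 := ptQ hφ hθ (Ioo_subset_Icc_self hp'.1) (Ioo_subset_Icc_self hp'.2) hp.1.1 hp.2.1
          rw [Hf, indicator_of_mem ((scp_mem_Q hk hl hp').2 ⟨hp.1.1, hp.2.1⟩), gf, qf, Real.norm_eq_abs]
          have e : scp p 2 * Kf (sc φ θ) (scp p) * ω (scp p) - 2 * sc φ θ 0 *
              (scp p 1 * scp p 2 / ‖scp p - x₀‖ ^ 4 * ω (scp p)) =
              (scp p 2 * Kf (sc φ θ) (scp p) - 2 * sc φ θ 0 *
              (scp p 1 * scp p 2 / ‖scp p - x₀‖ ^ 4)) * ω (scp p) := by ring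
          rw [e, abs_mul]
          have h3 : 0 ≤ CF * ((φ + θ) / (p.1 + p.2) ^ 3) := (abs_nonneg _).trans h1
          calc _ ≤ CF * ((φ + θ) / (p.1 + p.2) ^ 3) * W := mul_le_mul h1 (hW _) (abs_nonneg _) h3
            _ = _ := by ring
      _ ≤ ENNReal.ofReal (CF * W) * 1 := by
          rw [lintegral_const_mul' _ _ ENNReal.ofReal_ne_top]
          gcongr
          exact lint_cubeD φ θ hφ0 h0.le (by positivity) (by linarith) (by linarith)
      _ = _ := mul_one _
  have bI : ∫⁻ p in DI, F p ≤ ENNReal.ofReal (18000 * 32 * W) := by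
    calc ∫⁻ p in DI, F p ≤ ∫⁻ p in DI, ENNReal.ofReal (18000 * W) *
            ENNReal.ofReal (1 / (√|p.1 - φ| * (|p.1 - φ| + θ)) * (1 / √|p.2 - θ|)) := by
          apply lintegral_mono_ae
          filter_upwards [ae_restrict_mem mI, ae_restrict_of_ae (ae_ne φ θ)] with p hp hne
          rw [hF, ← ENNReal.ofReal_mul (by positivity)]
          apply ENNReal.ofReal_le_ofReal
          have hp' := sI p hp
          have h1 := ptI hφ hθ (Ioo_subset_Icc_self hp'.1) (Ioo_subset_Icc_self hp'.2) h0 hne.1 hne.2 hp.2.2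
          rw [hout p hp' (fun h => absurd h.2 (not_lt.2 hp.2.2))]
          calc _ ≤ 18000 * (1 / (√|p.1 - φ| * (|p.1 - φ| + θ)) * (1 / √|p.2 - θ|)) * W :=
                mul_le_mul h1 (hW _) (abs_nonneg _) (by positivity)
            _ = _ := by ring
      _ ≤ ENNReal.ofReal (18000 * W) * ENNReal.ofReal (32 * √θ / √θ) := by
          rw [lintegral_const_mul' _ _ ENNReal.ofReal_ne_top]
          gcongr
          refine lint_I φ θ hφ0 hφ1 h0 θ _ ?_ h0.le
          rintro x ⟨hx1, hx2⟩
          rw [abs_lt]; constructor <;> linarith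
      _ = _ := by
          rw [← ENNReal.ofReal_mul (by positivity)]
          have := sqrt_pos.2 h0
          congr 1
          field_simp
  have bII : ∫⁻ p in DII, F p ≤ ENNReal.ofReal (18000 * B) := by
    calc ∫⁻ p in DII, F p ≤ ∫⁻ p in DII, ENNReal.ofReal 18000 *
            ENNReal.ofReal (|ω (scp p)| * (1 / ((p.1 - φ) ^ 2 + p.2 ^ 2))) := by
          refine setLIntegral_mono' mII fun p hp => ?_
          rw [hF, ← ENNReal.ofReal_mul (by positivity)]
          apply ENNReal.ofReal_le_ofReal
          have hp' := sII p hp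
          have h1 := ptII hφ hθ (Ioo_subset_Icc_self hp'.1) (Ioo_subset_Icc_self hp'.2) hp'.2.1 hp.2.1.le
          rw [hout p hp' (fun h => absurd h.1 (not_lt.2 hp.1.2.le))]
          calc _ ≤ 18000 * (1 / ((p.1 - φ) ^ 2 + p.2 ^ 2)) * |ω (scp p)| :=
                mul_le_mul_of_nonneg_right h1 (abs_nonneg _)
            _ = _ := by ring
      _ ≤ ENNReal.ofReal 18000 * ENNReal.ofReal B := by
          rw [lintegral_const_mul' _ _ ENNReal.ofReal_ne_top]
          gcongr
      _ = _ := by rw [← ENNReal.ofReal_mul (by positivity)]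
  have hsub : Dq ≤ᵐ[volume] ((DQ ∪ DI) ∪ DII : Set (ℝ × ℝ)) := by
    filter_upwards [ae_ne (3 * φ / 2) 0] with p hne hp
    have hp : p ∈ Dq := hp
    show p ∈ (DQ ∪ DI) ∪ DII
    by_cases h1 : p.2 ≤ 3 * θ / 2
    · exact Or.inl (Or.inr ⟨hp.1, ⟨hp.2.1, h1⟩⟩)
    · push Not at h1
      rcases lt_or_gt_of_ne hne.1 with h2 | h2
      · exact Or.inr ⟨⟨hp.1.1, h2⟩, ⟨h1, hp.2.2⟩⟩
      · exact Or.inl (Or.inl ⟨⟨h2, hp.1.2⟩, ⟨h1, hp.2.2⟩⟩)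
  have tot : ∫⁻ y, ENNReal.ofReal ‖Hf φ θ ω y‖ ∂sgq ≤
      ENNReal.ofReal (4 * ((CF * W + 18000 * 32 * W) + 18000 * B)) := by
    refine (lint_sgq_le _ (by fun_prop)).trans ?_
    rw [ENNReal.ofReal_mul (by norm_num), ENNReal.ofReal_add (by positivity) (by positivity),
      ENNReal.ofReal_add (by positivity) (by positivity)]
    have e : ENNReal.ofReal 4 = 4 := by simp
    rw [e]
    gcongr
    calc ∫⁻ p in Dq, F p ≤ ∫⁻ p in (DQ ∪ DI) ∪ DII, F p := lintegral_mono_set' hsub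
      _ ≤ (∫⁻ p in DQ ∪ DI, F p) + ∫⁻ p in DII, F p := lintegral_union_le _ _ _
      _ ≤ ((∫⁻ p in DQ, F p) + ∫⁻ p in DI, F p) + ∫⁻ p in DII, F p := by
          gcongr; exact lintegral_union_le _ _ _
      _ ≤ _ := by gcongr
  have := norm_integral_le_lintegral_norm (μ := sgq) (Hf φ θ ω)
  rw [Real.norm_eq_abs] at this
  refine this.trans ?_
  apply ENNReal.toReal_le_of_le_ofReal (by positivity) tot

lemma fin_step {k I T : ℝ} (hk : 0 ≤ k) (h : |I| ≤ T) : |k * ((2 / π) * I)| ≤ k * T := by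
  have hpi := pi_gt_three
  have h1 : 2 / π ≤ 1 := by rw [div_le_one pi_pos]; linarith
  rw [abs_mul, abs_of_nonneg hk, abs_mul, abs_of_nonneg (by positivity : 0 ≤ 2 / π)]
  gcongr
  calc 2 / π * |I| ≤ 1 * |I| := by gcongr
    _ ≤ T := by linarith

/-- Key velocity estimate (Lemma 2.1), `θ`-component. The bound by the
minimum of the two expressions is phrased as a conjunction: the first (logarithmic) bound
applies whenever `θ ≠ 0` (when `θ = 0` that expression is `+∞`), and the second bound
applies for every Lipschitz constant `M` of `ω̃` on `[0, 3φ/2]²`. -/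
theorem velocity_estimate_theta :
    ∃ C₁ : ℝ, 1 ≤ C₁ ∧
      ∀ (ω : E3 → ℝ) (W : ℝ), Measurable ω → (∀ y, |ω y| ≤ W) → OddOdd ω →
        ∀ φ ∈ Icc (0:ℝ) 1, ∀ θ ∈ Icc (0:ℝ) 1, (φ, θ) ≠ (0, 0) →
          (θ ≠ 0 →
            |dot3 (biotSavart ω (sc φ θ)) (etheta (sc φ θ)) -
                ((sc φ θ) 2 / sqrt (1 - ((sc φ θ) 2) ^ 2)) * ((4 * (sc φ θ) 0 / Real.pi) *
                  ∫ y in Qset (3 * φ / 2) (3 * θ / 2),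
                    y 1 * y 2 / ‖y - x₀‖ ^ 4 * ω y ∂sigma2)| ≤
              ((sc φ θ) 2 / sqrt (1 - ((sc φ θ) 2) ^ 2)) * C₁ *
                (W * (1 + log (1 + φ / θ)))) ∧
          (∀ M : ℝ≥0,
            LipschitzOnWith M (fun p : ℝ × ℝ => ω (sc p.1 p.2))
              (Icc (0:ℝ) (3 * φ / 2) ×ˢ Icc (0:ℝ) (3 * φ / 2)) →
            |dot3 (biotSavart ω (sc φ θ)) (etheta (sc φ θ)) -
                ((sc φ θ) 2 / sqrt (1 - ((sc φ θ) 2) ^ 2)) * ((4 * (sc φ θ) 0 / Real.pi) *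
                  ∫ y in Qset (3 * φ / 2) (3 * θ / 2),
                    y 1 * y 2 / ‖y - x₀‖ ^ 4 * ω y ∂sigma2)| ≤
              ((sc φ θ) 2 / sqrt (1 - ((sc φ θ) 2) ^ 2)) * C₁ * (W + M * φ)) := by
  have hCF : 0 ≤ CF := by unfold CF; norm_num
  refine ⟨4 * (CF + 18000 * 32 + 18000 * 8), by nlinarith, ?_⟩
  intro ω W hm hW ho φ hφ θ hθ hne
  have hpi := pi_gt_three
  have hW0 : 0 ≤ W := (abs_nonneg _).trans (hW 0)
  have hx := sc_nonneg (a := φ) (b := θ) ⟨hφ.1, by linarith [hφ.2]⟩ ⟨hθ.1, by linarith [hθ.2]⟩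
  have hk : 0 ≤ (sc φ θ) 2 / sqrt (1 - ((sc φ θ) 2) ^ 2) := div_nonneg hx.2.1 (sqrt_nonneg _)
  constructor
  · intro hθ0
    have h0 : 0 < θ := lt_of_le_of_ne hθ.1 (Ne.symm hθ0)
    have hl : 0 ≤ log (1 + φ / θ) := by
      apply log_nonneg; have := div_nonneg hφ.1 h0.le; linarith
    rw [main_id ω W hm hW ho φ θ hφ hθ h0, mul_assoc]
    apply fin_step hk
    refine (H_bound ω W hm hW φ θ hφ hθ h0 (W * (8 * log (1 + φ / θ))) (by positivity) ?_).trans ?_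
    · calc _ ≤ ∫⁻ p in Ioo 0 (3 * φ / 2) ×ˢ Ioo (3 * θ / 2) (π/2),
            ENNReal.ofReal W * ENNReal.ofReal (1 / ((p.1 - φ) ^ 2 + p.2 ^ 2)) := by
            apply lintegral_mono
            intro p
            simp only
            rw [← ENNReal.ofReal_mul hW0]
            apply ENNReal.ofReal_le_ofReal
            exact mul_le_mul_of_nonneg_right (hW _) (by positivity)
        _ ≤ _ := by
            rw [lintegral_const_mul' _ _ ENNReal.ofReal_ne_top, ENNReal.ofReal_mul hW0]
            gcongr
            exact lint_II_log φ θ hφ.1 h0 (by linarith [hθ.2])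
    · have := mul_nonneg hW0 hl
      have h3 := mul_nonneg hCF this
      have h4 := mul_nonneg hCF hW0
      linarith
  · intro M hM
    rcases eq_or_lt_of_le hθ.1 with h0 | h0
    · subst h0
      rw [main_zero ω W hm hW ho φ hφ]
      simp [sc]
    have hMφ : 0 ≤ M * φ := mul_nonneg M.2 hφ.1
    rw [main_id ω W hm hW ho φ θ hφ hθ h0, mul_assoc]
    apply fin_step hk
    refine (H_bound ω W hm hW φ θ hφ hθ h0 (6 * (W + M * φ)) (by positivity) ?_).trans ?_
    · rcases eq_or_lt_of_le hφ.1 with hz | hz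
      · rw [← hz]; simp
      refine le_trans ?_ (lint_II_lip φ θ M W M.2 hW0 hz hφ.2 h0)
      refine setLIntegral_mono' (measurableSet_Ioo.prod measurableSet_Ioo) fun p hp => ?_
      apply ENNReal.ofReal_le_ofReal
      refine mul_le_mul_of_nonneg_right ?_ (by positivity)
      split_ifs with hc
      · have hb : 0 < p.2 := lt_trans (by positivity) hp.2.1
        have hodd := (ho (sc p.1 0) (sc_mem _ _)).2
        rw [flip3_sc, neg_zero] at hodd
        have hz0 : ω (sc p.1 0) = 0 := by linarith
        have := hM.dist_le_mul (p.1, p.2) ⟨⟨hp.1.1.le, hp.1.2.le⟩, ⟨hb.le, hc⟩⟩ (p.1, 0)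
          ⟨⟨hp.1.1.le, hp.1.2.le⟩, ⟨le_rfl, by positivity⟩⟩
        simp only [hz0, Prod.dist_eq, dist_self, Real.dist_eq, sub_zero, abs_of_pos hb] at this
        rwa [max_eq_right hb.le] at this
      · exact hW _
    · have h3 := mul_nonneg hCF hMφ
      have h4 := mul_nonneg hCF hW0
      linarith
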